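/- arXiv:2202.13345 — 12 statements merged into one kernel-verified Lean document; each statement's English description precedes it below -/
import Mathlib

section
/- Let (X, f_{0,∞}) be a non-autonomous dynamical system on a compact metric space. For every k ≥ 1, the topological entropy of the k-fold product system satisfies h(f_{0,∞}^{(k)}) = k · h(f_{0,∞}). -/
open Filter Topology

/-- `comps f n` is `f_0^n = f_{n-1} ∘ ⋯ ∘ f_0`. -/
def comps {X : Type*} (f : ℕ → X → X) : ℕ → X → X
  | 0 => id
  | n + 1 => f n ∘ comps f n

/-- `E` is an `(n, ε)`-separated set for the non-autonomous system `f`. -/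
def IsSeparated {X : Type*} [MetricSpace X] (f : ℕ → X → X) (n : ℕ) (ε : ℝ) (E : Set X) : Prop :=
  ∀ x ∈ E, ∀ y ∈ E, x ≠ y → ∃ k < n, ε < dist (comps f k x) (comps f k y)

/-- The maximal cardinality of an `(n, ε)`-separated set. -/
noncomputable def sepNum {X : Type*} [MetricSpace X] (f : ℕ → X → X) (n : ℕ) (ε : ℝ) : ℕ :=
  sSup {m | ∃ E : Finset X, IsSeparated f n ε ↑E ∧ E.card = m}

/-- The topological entropy of the non-autonomous system `(X, f_{0,∞})`,
`h(f) = lim_{ε→0} limsup_n (1/n) log s_n(ε)`; by antitonicity of `s_n` in `ε`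
the limit as `ε → 0⁺` is the supremum over `ε > 0`. -/
noncomputable def sepEntropy {X : Type*} [MetricSpace X] (f : ℕ → X → X) : EReal :=
  ⨆ ε : {e : ℝ // 0 < e},
    Filter.limsup (fun n : ℕ => ((Real.log (sepNum f n ε) / n : ℝ) : EReal)) Filter.atTop

theorem aux_comps_pi {X : Type*} (f : ℕ → X → X) (k : ℕ) (j : ℕ) (x : Fin k → X) (i : Fin k) :
    comps (fun n (x : Fin k → X) (i : Fin k) => f n (x i)) j x i = comps f j (x i) := by
  induction j with
  | zero => rfl
  | succ j ih =>
    simp only [comps, Function.comp_apply]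
    rw [ih]

theorem aux_comps_cont {X : Type*} [MetricSpace X] (f : ℕ → X → X) (hf : ∀ n, Continuous (f n))
    (j : ℕ) : Continuous (comps f j) := by
  induction j with
  | zero => exact continuous_id
  | succ j ih => exact (hf j).comp ih

theorem aux_bdd {X : Type*} [MetricSpace X] [CompactSpace X]
    (f : ℕ → X → X) (hf : ∀ n, Continuous (f n)) (n : ℕ) (ε : ℝ) (hε : 0 < ε) :
    BddAbove {m | ∃ E : Finset X, IsSeparated f n ε ↑E ∧ E.card = m} := by
  classical
  obtain ⟨t, htf, ht⟩ := Metric.totallyBounded_iff.1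
    (isCompact_univ (X := Fin n → X)).totallyBounded (ε / 2) (half_pos hε)
  have hc : ∀ x : X, ∃ y ∈ htf.toFinset,
      dist (fun j : Fin n => comps f j x) y < ε / 2 := by
    intro x
    have := ht (Set.mem_univ (fun j : Fin n => comps f j x))
    simpa using this
  choose c hc1 hc2 using hc
  refine ⟨htf.toFinset.card, ?_⟩
  rintro m ⟨E, hE, rfl⟩
  refine Finset.card_le_card_of_injOn c (fun x _ => hc1 x) ?_
  intro x hx y hy hxy
  by_contra hne
  obtain ⟨j, hj, hd⟩ := hE x hx y hy hne
  have h1 := dist_le_pi_dist (fun j : Fin n => comps f j x) (c x) ⟨j, hj⟩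
  have h2 := dist_le_pi_dist (fun j : Fin n => comps f j y) (c y) ⟨j, hj⟩
  have h3 := hc2 x
  have h4 := hc2 y
  rw [← hxy] at h2 h4
  have h5 := dist_triangle_right (comps f j x) (comps f j y) (c x ⟨j, hj⟩)
  simp only at h1 h2
  linarith

theorem aux_exists {X : Type*} [MetricSpace X] (f : ℕ → X → X) (n : ℕ) (ε : ℝ)
    (hb : BddAbove {m | ∃ E : Finset X, IsSeparated f n ε ↑E ∧ E.card = m}) :
    ∃ E : Finset X, IsSeparated f n ε ↑E ∧ E.card = sepNum f n ε :=
  Nat.sSup_mem (s := {m | ∃ E : Finset X, IsSeparated f n ε ↑E ∧ E.card = m})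
    ⟨0, ∅, by simp [IsSeparated], rfl⟩ hb

theorem aux_span {X : Type*} [MetricSpace X] (f : ℕ → X → X) (n : ℕ) (ε : ℝ) (hε : 0 < ε)
    (hb : BddAbove {m | ∃ E : Finset X, IsSeparated f n ε ↑E ∧ E.card = m}) :
    ∃ E : Finset X, E.card = sepNum f n ε ∧
      ∀ x, ∃ e ∈ E, ∀ j < n, dist (comps f j x) (comps f j e) ≤ ε := by
  classical
  obtain ⟨E, hE, hcard⟩ := aux_exists f n ε hb
  refine ⟨E, hcard, fun x => ?_⟩
  by_contra! hx
  have hxE : x ∉ E := by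
    intro h
    obtain ⟨j, _, hj⟩ := hx x h
    simp at hj
    linarith
  have : (insert x E).card ≤ sepNum f n ε := by
    refine le_csSup hb ⟨insert x E, ?_, rfl⟩
    intro a ha b hb hab
    simp only [Finset.coe_insert, Set.mem_insert_iff, Finset.mem_coe] at ha hb
    rcases ha with rfl | ha
    · rcases hb with rfl | hb
      · exact absurd rfl hab
      · exact hx b hb
    · rcases hb with rfl | hb
      · obtain ⟨j, hj, h⟩ := hx a ha
        exact ⟨j, hj, by rwa [dist_comm]⟩
      · exact hE a ha b hb hab
  rw [Finset.card_insert_of_notMem hxE] at this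
  omega

theorem aux_upper {X : Type*} [MetricSpace X] [CompactSpace X]
    (f : ℕ → X → X) (hf : ∀ n, Continuous (f n)) (k : ℕ) (n : ℕ) (ε : ℝ) (hε : 0 < ε)
    (A : Finset (Fin k → X))
    (hA : IsSeparated (fun n (x : Fin k → X) (i : Fin k) => f n (x i)) n ε (A : Set (Fin k → X))) :
    A.card ≤ sepNum f n (ε / 2) ^ k := by
  classical
  obtain ⟨E, hc, hE⟩ := aux_span f n (ε / 2) (half_pos hε) (aux_bdd f hf n _ (half_pos hε))
  choose c hc1 hc2 using hE
  have : A.card ≤ (Fintype.piFinset (fun _ : Fin k => E)).card := by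
    refine Finset.card_le_card_of_injOn (fun x i => c (x i)) (fun x _ => by simp [hc1]) ?_
    intro x hx y hy hxy
    by_contra hne
    obtain ⟨j, hj, hd⟩ := hA x hx y hy hne
    refine absurd hd (not_lt.2 ((dist_pi_le_iff hε.le).2 fun i => ?_))
    rw [aux_comps_pi, aux_comps_pi]
    have h1 := hc2 (x i) j hj
    have h2 := hc2 (y i) j hj
    have h3 : c (x i) = c (y i) := congrFun hxy i
    rw [← h3] at h2
    have := dist_triangle_right (comps f j (x i)) (comps f j (y i)) (comps f j (c (x i)))
    linarith
  simpa [hc] using this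

theorem aux_sep_le {X : Type*} [MetricSpace X] [CompactSpace X]
    (f : ℕ → X → X) (hf : ∀ n, Continuous (f n)) (k : ℕ) (n : ℕ) (ε : ℝ) (hε : 0 < ε) :
    sepNum (fun n (x : Fin k → X) (i : Fin k) => f n (x i)) n ε ≤ sepNum f n (ε / 2) ^ k := by
  refine csSup_le ⟨0, ∅, by simp [IsSeparated], rfl⟩ ?_
  rintro m ⟨A, hA, rfl⟩
  exact aux_upper f hf k n ε hε A hA

theorem aux_le_sep {X : Type*} [MetricSpace X] [CompactSpace X]
    (f : ℕ → X → X) (hf : ∀ n, Continuous (f n)) (k : ℕ) (n : ℕ) (ε : ℝ) (hε : 0 < ε) :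
    sepNum f n ε ^ k ≤ sepNum (fun n (x : Fin k → X) (i : Fin k) => f n (x i)) n ε := by
  classical
  obtain ⟨E, hE, hc⟩ := aux_exists f n ε (aux_bdd f hf n _ hε)
  refine le_csSup ⟨sepNum f n (ε / 2) ^ k, ?_⟩ ⟨Fintype.piFinset (fun _ : Fin k => E), ?_, ?_⟩
  · rintro m ⟨A, hA, rfl⟩
    exact aux_upper f hf k n ε hε A hA
  · intro x hx y hy hxy
    simp only [Finset.mem_coe, Fintype.mem_piFinset] at hx hy
    obtain ⟨i, hi⟩ := Function.ne_iff.1 hxy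
    obtain ⟨j, hj, hd⟩ := hE _ (hx i) _ (hy i) hi
    refine ⟨j, hj, hd.trans_le ?_⟩
    have := dist_le_pi_dist (comps (fun n (x : Fin k → X) (i : Fin k) => f n (x i)) j x)
      (comps (fun n (x : Fin k → X) (i : Fin k) => f n (x i)) j y) i
    rwa [aux_comps_pi, aux_comps_pi] at this
  · simp [hc]

theorem aux_log_mono {a b : ℕ} (h : a ≤ b) : Real.log a ≤ Real.log b := by
  rcases Nat.eq_zero_or_pos a with rfl | ha
  · simpa using Real.log_natCast_nonneg b
  · exact Real.log_le_log (by exact_mod_cast ha) (by exact_mod_cast h)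

theorem aux_mono (k : ℕ) : Monotone (fun x : EReal => (k : EReal) * x) :=
  fun _ _ h => mul_le_mul_of_nonneg_left h (by positivity)

theorem aux_cont (k : ℕ) (hk : 1 ≤ k) : Continuous (fun x : EReal => (k : EReal) * x) := by
  have h0 : (k : EReal) ≠ 0 := by
    have : k ≠ 0 := by omega
    exact_mod_cast this
  have h1 : (k : EReal) ≠ ⊥ := EReal.natCast_ne_bot k
  have h2 : (k : EReal) ≠ ⊤ := EReal.natCast_ne_top k
  refine continuous_iff_continuousAt.2 fun x => ?_
  have := EReal.continuousAt_mul (p := ((k : EReal), x)) (Or.inl h0) (Or.inl h0)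
    (Or.inl h1) (Or.inl h2)
  exact this.comp (f := fun x : EReal => ((k : EReal), x)) (by fun_prop)

theorem aux_limsup (k : ℕ) (hk : 1 ≤ k) (s : ℕ → ℕ) :
    limsup (fun n : ℕ => ((Real.log ((s n ^ k : ℕ) : ℝ) / n : ℝ) : EReal)) atTop =
      (k : EReal) * limsup (fun n : ℕ => ((Real.log (s n) / n : ℝ) : EReal)) atTop := by
  have h := (aux_mono k).map_limsup_of_continuousAt (F := atTop)
    (fun n : ℕ => ((Real.log (s n) / n : ℝ) : EReal)) (aux_cont k hk).continuousAt
  rw [h]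
  congr 1
  funext n
  simp only [Function.comp_apply]
  rw [Nat.cast_pow, Real.log_pow, mul_div_assoc, EReal.coe_mul]
  rfl

/-- For every `k ≥ 1`, `h(f^{(k)}) = k · h(f)`, where `f_n^{(k)} = f_n × ⋯ × f_n`
acts on `X^k` (here `Fin k → X`, which carries the max metric). -/
theorem sepEntropy_pow {X : Type*} [MetricSpace X] [CompactSpace X]
    (f : ℕ → X → X) (hf : ∀ n, Continuous (f n)) (k : ℕ) (hk : 1 ≤ k) :
    sepEntropy (fun n (x : Fin k → X) (i : Fin k) => f n (x i)) =
      (k : EReal) * sepEntropy f := by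
  haveI : Nonempty {e : ℝ // 0 < e} := ⟨⟨1, one_pos⟩⟩
  unfold sepEntropy
  rw [Monotone.map_ciSup_of_continuousAt (aux_cont k hk).continuousAt (aux_mono k)
    (OrderTop.bddAbove _)]
  apply le_antisymm
  · refine iSup_le fun ε => ?_
    refine le_iSup_of_le ⟨ε.1 / 2, half_pos ε.2⟩ ?_
    rw [← aux_limsup k hk]
    refine limsup_le_limsup (Eventually.of_forall fun n => ?_)
    refine EReal.coe_le_coe_iff.2 (div_le_div_of_nonneg_right ?_ n.cast_nonneg)
    exact aux_log_mono (aux_sep_le f hf k n ε.1 ε.2)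
  · refine iSup_le fun ε => ?_
    refine le_iSup_of_le ε ?_
    rw [← aux_limsup k hk]
    refine limsup_le_limsup (Eventually.of_forall fun n => ?_)
    refine EReal.coe_le_coe_iff.2 (div_le_div_of_nonneg_right ?_ n.cast_nonneg)
    exact aux_log_mono (aux_le_sep f hf k n ε.1 ε.2)
end

section
/- Let (X, f_{0,∞}) be a non-autonomous dynamical system on a compact metric space with f_{0,∞} equi-continuous. If h(f_{0,∞}) > 0, then the induced hyperspace system has infinite topological entropy: h(\bar f_{0,∞}) = +∞. -/
open Filter Topology TopologicalSpace

/-- The sequence `f` is equi-continuous. -/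
def EquiCont {X : Type*} [MetricSpace X] (f : ℕ → X → X) : Prop :=
  ∀ ε > (0 : ℝ), ∃ δ > (0 : ℝ), ∀ x y : X, dist x y < δ → ∀ n : ℕ, dist (f n x) (f n y) < ε

theorem comps_modulus {X : Type*} [MetricSpace X] {f : ℕ → X → X} (hef : EquiCont f)
    (m : ℕ) (ε : ℝ) (hε : 0 < ε) :
    ∃ δ > (0 : ℝ), ∀ (x y : X) (s : ℕ), dist (comps f s x) (comps f s y) ≤ δ →
      ∀ r < m, dist (comps f (s + r) x) (comps f (s + r) y) < ε := by
  induction m with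
  | zero => exact ⟨1, one_pos, fun x y s _ r hr => absurd hr (Nat.not_lt_zero r)⟩
  | succ m ih =>
    obtain ⟨δ, hδ, h⟩ := ih
    obtain ⟨η, hη, h'⟩ := hef δ hδ
    refine ⟨min (η / 2) (ε / 2), by positivity, fun x y s hd r hr => ?_⟩
    have h1 : dist (comps f s x) (comps f s y) < η :=
      lt_of_le_of_lt (hd.trans (min_le_left _ _)) (by linarith)
    have h2 : dist (comps f s x) (comps f s y) < ε :=
      lt_of_le_of_lt (hd.trans (min_le_right _ _)) (by linarith)
    cases r with
    | zero => exact h2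
    | succ r =>
      have h3 : dist (comps f (s + 1) x) (comps f (s + 1) y) ≤ δ := (h' _ _ h1 s).le
      have h4 := h x y (s + 1) h3 r (by omega)
      have e : s + (r + 1) = s + 1 + r := by omega
      rw [e]; exact h4

theorem sep_bdd {X : Type*} [MetricSpace X] [CompactSpace X] {f : ℕ → X → X} (hef : EquiCont f)
    (n : ℕ) (ε : ℝ) (hε : 0 < ε) :
    BddAbove {m | ∃ E : Finset X, IsSeparated f n ε ↑E ∧ E.card = m} := by
  obtain ⟨δ, hδ, h⟩ := comps_modulus hef n ε hε
  obtain ⟨t, htf, hc⟩ := Metric.totallyBounded_iff.1 (isCompact_univ (X := X)).totallyBounded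
    (δ / 2) (by positivity)
  refine ⟨htf.toFinset.card, ?_⟩
  rintro _ ⟨E, hE, rfl⟩
  have hc' : ∀ x : X, ∃ y ∈ t, dist x y < δ / 2 := by
    intro x
    simpa using hc (Set.mem_univ x)
  choose g hg hgd using hc'
  refine Finset.card_le_card_of_injOn g (fun x _ => by simpa using hg x) ?_
  intro x hx y hy hxy
  by_contra hne
  obtain ⟨k, hk, hlt⟩ := hE x hx y hy hne
  have hd : dist x y ≤ δ := by
    have h1 := hgd x
    have h2 := hgd y
    rw [← hxy] at h2
    have := dist_triangle_right x y (g x)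
    linarith
  have := h x y 0 hd k hk
  rw [Nat.zero_add] at this
  linarith

theorem equiCont_hyper {X : Type*} [MetricSpace X] [CompactSpace X]
    {f : ℕ → X → X} (hef : EquiCont f)
    {F : ℕ → NonemptyCompacts X → NonemptyCompacts X}
    (hF : ∀ n (K : NonemptyCompacts X), (F n K : Set X) = f n '' ↑K) : EquiCont F := by
  intro ε hε
  obtain ⟨δ, hδ, h⟩ := hef (ε / 2) (by positivity)
  refine ⟨δ, hδ, fun A B hAB n => ?_⟩
  rw [Metric.NonemptyCompacts.dist_eq] at hAB ⊢
  have hfin : Metric.hausdorffEDist (A : Set X) (B : Set X) ≠ ⊤ :=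
    Metric.hausdorffEDist_ne_top_of_nonempty_of_bounded A.nonempty B.nonempty
      A.isCompact.isBounded B.isCompact.isBounded
  refine lt_of_le_of_lt (b := ε / 2) ?_ (by linarith)
  rw [hF, hF]
  apply Metric.hausdorffDist_le_of_mem_dist (by positivity)
  · rintro _ ⟨x, hx, rfl⟩
    obtain ⟨y, hy, hxy⟩ := Metric.exists_dist_lt_of_hausdorffDist_lt hx hAB hfin
    exact ⟨f n y, ⟨y, hy, rfl⟩, (h _ _ hxy n).le⟩
  · rintro _ ⟨x, hx, rfl⟩
    obtain ⟨y, hy, hxy⟩ := Metric.exists_dist_lt_of_hausdorffDist_lt' hx hAB hfin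
    exact ⟨f n y, ⟨y, hy, rfl⟩, by rw [dist_comm]; exact (h _ _ hxy n).le⟩

theorem comps_hyper {X : Type*} [MetricSpace X]
    {f : ℕ → X → X} {F : ℕ → NonemptyCompacts X → NonemptyCompacts X}
    (hF : ∀ n (K : NonemptyCompacts X), (F n K : Set X) = f n '' ↑K) (n : ℕ)
    (K : NonemptyCompacts X) : ((comps F n K : NonemptyCompacts X) : Set X) = comps f n '' ↑K := by
  induction n with
  | zero => simp [comps]
  | succ n ih => simp only [comps, Function.comp, hF, ih, Set.image_image]

/-- Number of points of a separated set whose orbit follows those of `k` given points. -/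
theorem follow_card {X : Type*} [MetricSpace X] {f : ℕ → X → X} {n m k : ℕ} (hm : 0 < m)
    {ε δ : ℝ}
    (hδ : ∀ (x y : X) (s : ℕ), dist (comps f s x) (comps f s y) ≤ δ →
      ∀ r < m, dist (comps f (s + r) x) (comps f (s + r) y) < ε / 2)
    (t : Fin (k + 1) → X) (Y : Finset X) (hsep : IsSeparated f n ε ↑Y)
    (hY : ∀ y ∈ Y, ∀ j < n, ∃ i, dist (comps f j y) (comps f j (t i)) ≤ δ) :
    Y.card ≤ (k + 1) ^ (n / m + 1) := by
  classical
  have hY' : ∀ y : X, ∀ b : Fin (n / m + 1), ∃ i : Fin (k + 1), y ∈ Y → (b : ℕ) * m < n →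
      dist (comps f (b * m) y) (comps f (b * m) (t i)) ≤ δ := by
    intro y b
    by_cases h : y ∈ Y ∧ (b : ℕ) * m < n
    · obtain ⟨i, hi⟩ := hY y h.1 _ h.2
      exact ⟨i, fun _ _ => hi⟩
    · exact ⟨0, fun h1 h2 => absurd ⟨h1, h2⟩ h⟩
  choose g hg using hY'
  have hle : Y.card ≤ (Finset.univ : Finset (Fin (n / m + 1) → Fin (k + 1))).card := by
    refine Finset.card_le_card_of_injOn g (fun _ _ => by simp) ?_
    intro x hx y hy hxy
    by_contra hne
    obtain ⟨j, hj, hlt⟩ := hsep x hx y hy hne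
    have hb : j / m < n / m + 1 := Nat.lt_succ_of_le (Nat.div_le_div_right hj.le)
    have hbn : j / m * m < n := lt_of_le_of_lt (Nat.div_mul_le_self j m) hj
    have h1 := hδ _ _ _ (hg x ⟨j / m, hb⟩ hx hbn) (j % m) (Nat.mod_lt _ hm)
    have h2 := hδ _ _ _ (hg y ⟨j / m, hb⟩ hy hbn) (j % m) (Nat.mod_lt _ hm)
    rw [← hxy] at h2
    simp only [Nat.div_add_mod'] at h1 h2
    have := dist_triangle_right (comps f j x) (comps f j y) (comps f j (t (g x ⟨j / m, hb⟩)))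
    linarith
  simpa using hle

/-- The nonempty compact set of values of a tuple. -/
noncomputable def tupleSet {X : Type*} [MetricSpace X] {k : ℕ} (t : Fin (k + 1) → X) :
    NonemptyCompacts X :=
  ⟨⟨Set.range t, (Set.finite_range t).isCompact⟩, Set.range_nonempty t⟩

theorem exists_maximal_sep {X : Type*} [MetricSpace X] (f : ℕ → X → X) (n : ℕ) (ε : ℝ)
    (T : Finset X) : ∃ S ⊆ T, IsSeparated f n ε ↑S ∧
      ∀ x ∈ T, ∃ y ∈ S, ∀ j < n, dist (comps f j x) (comps f j y) ≤ max ε 0 := by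
  classical
  obtain ⟨S, hS, hmax⟩ := Finset.exists_max_image
    (T.powerset.filter fun S : Finset X => IsSeparated f n ε (S : Set X)) Finset.card
    ⟨∅, by simp [IsSeparated]⟩
  simp only [Finset.mem_filter, Finset.mem_powerset] at hS hmax
  refine ⟨S, hS.1, hS.2, fun x hx => ?_⟩
  by_contra! hcon
  have hcon' : ∀ y ∈ S, ∃ j < n, ε < dist (comps f j x) (comps f j y) := fun y hy => by
    obtain ⟨j, hj, h⟩ := hcon y hy
    exact ⟨j, hj, (le_max_left _ _).trans_lt h⟩
  have hxS : x ∉ S := fun h => by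
    obtain ⟨j, _, h⟩ := hcon x h
    rw [dist_self] at h
    exact absurd h (not_lt.2 (le_max_right _ _))
  have := hmax (insert x S) ⟨Finset.insert_subset hx hS.1, ?_⟩
  · rw [Finset.card_insert_of_notMem hxS] at this
    omega
  · intro a ha b hb hab
    simp only [Finset.coe_insert, Set.mem_insert_iff, Finset.mem_coe] at ha hb
    rcases ha with rfl | ha <;> rcases hb with rfl | hb
    · exact absurd rfl hab
    · exact hcon' b hb
    · obtain ⟨j, hj, h⟩ := hcon' a ha
      exact ⟨j, hj, by rwa [dist_comm]⟩
    · exact hS.2 a ha b hb hab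

theorem hyper_count {X : Type*} [MetricSpace X] [CompactSpace X]
    {f : ℕ → X → X} (hef : EquiCont f)
    {F : ℕ → NonemptyCompacts X → NonemptyCompacts X}
    (hF : ∀ n (K : NonemptyCompacts X), (F n K : Set X) = f n '' ↑K)
    (k m : ℕ) (hm : 0 < m) (ε : ℝ) (hε : 0 < ε) :
    ∃ δ > (0 : ℝ), ∀ n, sepNum f n ε ^ (k + 1) ≤
      sepNum F n δ * ((k + 1) ^ (n / m + 1)) ^ (k + 1) := by
  classical
  obtain ⟨δ, hδ, h⟩ := comps_modulus hef m (ε / 2) (by positivity)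
  refine ⟨δ / 2, by positivity, fun n => ?_⟩
  obtain ⟨E, hE, hEc⟩ : sepNum f n ε ∈
      {m | ∃ E : Finset X, IsSeparated f n ε ↑E ∧ E.card = m} :=
    Nat.sSup_mem ⟨0, ∅, by simp [IsSeparated], rfl⟩ (sep_bdd hef n ε hε)
  set T : Finset (Fin (k + 1) → X) := Fintype.piFinset fun _ => E with hT
  obtain ⟨S, hST, hSsep, hScov⟩ := exists_maximal_sep F n (δ / 2) (T.image tupleSet)
  have hScard : S.card ≤ sepNum F n (δ / 2) :=
    le_csSup (sep_bdd (equiCont_hyper hef hF) n (δ / 2) (by positivity)) ⟨S, hSsep, rfl⟩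
  have hcov : ∀ u : Fin (k + 1) → X, ∃ A, u ∈ T → A ∈ S ∧
      ∀ j < n, dist (comps F j (tupleSet u)) (comps F j A) ≤ δ / 2 := by
    intro u
    by_cases hu : u ∈ T
    · obtain ⟨A, hA, hd⟩ := hScov _ (Finset.mem_image_of_mem tupleSet hu)
      rw [max_eq_left (by positivity)] at hd
      exact ⟨A, fun _ => ⟨hA, hd⟩⟩
    · exact ⟨tupleSet u, fun h => absurd h hu⟩
  choose G hG using hcov
  have hmain : T.card ≤ ((k + 1) ^ (n / m + 1)) ^ (k + 1) * S.card := by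
    refine Finset.card_le_mul_card_image_of_maps_to (f := G) (fun u hu => (hG u hu).1) _ ?_
    intro A hA
    obtain ⟨t, -, rfl⟩ := Finset.mem_image.1 (hST hA)
    set Y : Finset X := E.filter fun y =>
      ∀ j < n, ∃ i, dist (comps f j y) (comps f j (t i)) ≤ δ with hYdef
    have hYc : Y.card ≤ (k + 1) ^ (n / m + 1) := by
      refine follow_card hm h t Y ?_ ?_
      · intro x hx y hy
        exact hE x (Finset.filter_subset _ _ hx) y (Finset.filter_subset _ _ hy)
      · intro y hy
        exact (Finset.mem_filter.1 hy).2
    have hsub : (T.filter fun u => G u = tupleSet t) ⊆ Fintype.piFinset fun _ => Y := by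
      intro u hu
      obtain ⟨huT, huG⟩ := Finset.mem_filter.1 hu
      have hd := (hG u huT).2
      rw [huG] at hd
      rw [Fintype.mem_piFinset]
      intro a
      refine Finset.mem_filter.2 ⟨Fintype.mem_piFinset.1 huT a, fun j hj => ?_⟩
      have hdj : dist (comps F j (tupleSet u)) (comps F j (tupleSet t)) < δ :=
        lt_of_le_of_lt (hd j hj) (by linarith)
      rw [Metric.NonemptyCompacts.dist_eq] at hdj
      have hfin : Metric.hausdorffEDist ((comps F j (tupleSet u) : NonemptyCompacts X) : Set X)
          ((comps F j (tupleSet t) : NonemptyCompacts X) : Set X) ≠ ⊤ :=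
        Metric.hausdorffEDist_ne_top_of_nonempty_of_bounded (NonemptyCompacts.nonempty _)
          (NonemptyCompacts.nonempty _) (NonemptyCompacts.isCompact _).isBounded
          (NonemptyCompacts.isCompact _).isBounded
      have hmem : comps f j (u a) ∈ ((comps F j (tupleSet u) : NonemptyCompacts X) : Set X) := by
        rw [comps_hyper hF]
        exact ⟨u a, ⟨a, rfl⟩, rfl⟩
      obtain ⟨z, hz, hzd⟩ := Metric.exists_dist_lt_of_hausdorffDist_lt hmem hdj hfin
      rw [comps_hyper hF] at hz
      obtain ⟨_, ⟨i, rfl⟩, rfl⟩ := hz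
      exact ⟨i, hzd.le⟩
    calc _ ≤ (Fintype.piFinset fun _ : Fin (k + 1) => Y).card := Finset.card_le_card hsub
      _ = Y.card ^ (k + 1) := by simp
      _ ≤ _ := Nat.pow_le_pow_left hYc _
  have hTc : T.card = sepNum f n ε ^ (k + 1) := by simp [hT, hEc]
  rw [← hTc, mul_comm]
  exact hmain.trans (Nat.mul_le_mul_left _ hScard)

theorem log_bound {N S k m n : ℕ} {a : ℝ} (ha : 0 < a) (hm : 0 < m) (hmn : m ≤ n)
    (hmk : 2 * (k + 1) * Real.log (k + 1) ≤ m)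
    (hN : a < Real.log N / n)
    (h : N ^ (k + 1) ≤ S * ((k + 1) ^ (n / m + 1)) ^ (k + 1)) :
    (k + 1) * a - 1 ≤ Real.log S / n := by
  have hn : (0 : ℝ) < n := by exact_mod_cast hm.trans_le hmn
  have hm' : (0 : ℝ) < m := by exact_mod_cast hm
  have hmn' : (m : ℝ) ≤ n := by exact_mod_cast hmn
  have hN0 : N ≠ 0 := by
    rintro rfl
    simp at hN
    linarith
  have hS0 : S ≠ 0 := by
    rintro rfl
    simp at h
    exact hN0 h
  rw [lt_div_iff₀ hn] at hN
  rw [le_div_iff₀ hn]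
  have hR : (N : ℝ) ^ (k + 1) ≤ S * (((k : ℝ) + 1) ^ (n / m + 1)) ^ (k + 1) := by
    exact_mod_cast h
  have hNpos : (0 : ℝ) < N := by exact_mod_cast Nat.pos_of_ne_zero hN0
  have hSpos : (0 : ℝ) < S := by exact_mod_cast Nat.pos_of_ne_zero hS0
  have hL := Real.log_le_log (by positivity) hR
  rw [Real.log_mul hSpos.ne' (by positivity), Real.log_pow, Real.log_pow, Real.log_pow] at hL
  push_cast at hL
  have hl0 : 0 ≤ Real.log ((k : ℝ) + 1) := Real.log_nonneg (by linarith [k.cast_nonneg (α := ℝ)])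
  have hq : (((n / m : ℕ) : ℝ) + 1) ≤ 2 * n / m := by
    have h1 : ((n / m : ℕ) : ℝ) ≤ n / m := Nat.cast_div_le
    have h2 : (1 : ℝ) ≤ n / m := by rwa [le_div_iff₀ hm', one_mul]
    have : (2 : ℝ) * n / m = n / m + n / m := by ring
    linarith
  have hk0 : (0 : ℝ) ≤ (k : ℝ) + 1 := by positivity
  have h3 : ((k : ℝ) + 1) * ((((n / m : ℕ) : ℝ) + 1) * Real.log ((k : ℝ) + 1)) ≤ n := by
    calc _ ≤ ((k : ℝ) + 1) * ((2 * n / m) * Real.log ((k : ℝ) + 1)) := by gcongr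
      _ = (2 * (k + 1) * Real.log (k + 1)) * n / m := by ring
      _ ≤ m * n / m := by gcongr
      _ = n := by field_simp
  have h4 : ((k : ℝ) + 1) * (a * n) ≤ (k + 1) * Real.log N := by gcongr
  nlinarith

/-- If `f_{0,∞}` is an equi-continuous sequence of continuous self-maps of a compact
metric space `X` and `h(f_{0,∞}) > 0`, then the induced system `\bar f_{0,∞}` on the
hyperspace `K(X)` of nonempty compact subsets (with the Hausdorff metric) has infinite
topological entropy. Here `F n` is the induced map, characterized by
`F n K = f n '' K` as subsets of `X`. -/
theorem sepEntropy_hyperspace_top {X : Type*} [MetricSpace X] [CompactSpace X]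
    (f : ℕ → X → X) (hf : ∀ n, Continuous (f n)) (hef : EquiCont f)
    (F : ℕ → NonemptyCompacts X → NonemptyCompacts X)
    (hF : ∀ n (K : NonemptyCompacts X), (F n K : Set X) = f n '' ↑K)
    (hpos : 0 < sepEntropy f) :
    sepEntropy F = ⊤ := by
  obtain ⟨⟨ε, hε⟩, hlim⟩ := lt_iSup_iff.1 hpos
  obtain ⟨a, ha0, ha⟩ := EReal.lt_iff_exists_real_btwn.1 hlim
  have ha0' : 0 < a := by exact_mod_cast ha0
  have hfreq := Filter.frequently_lt_of_lt_limsup (by isBoundedDefault) ha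
  rw [EReal.eq_top_iff_forall_lt]
  intro M
  obtain ⟨k, hk⟩ := exists_nat_gt ((M + 2) / a)
  obtain ⟨m, hm⟩ := exists_nat_gt (2 * ((k : ℝ) + 1) * Real.log (k + 1))
  have hm0 : 0 < m := by
    have : 0 ≤ Real.log ((k : ℝ) + 1) := Real.log_nonneg (by linarith [k.cast_nonneg (α := ℝ)])
    have h2 : (0 : ℝ) < m := lt_of_le_of_lt (by positivity) hm
    exact_mod_cast h2
  obtain ⟨δ, hδ, hcount⟩ := hyper_count hef hF k m hm0 ε hε
  have hMk : M < (k + 1) * a - 1 := by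
    rw [div_lt_iff₀ ha0'] at hk
    nlinarith
  refine lt_of_lt_of_le (EReal.coe_lt_coe_iff.2 hMk) ?_
  refine le_trans ?_ (le_iSup (fun ε : {e : ℝ // 0 < e} => Filter.limsup
    (fun n : ℕ => ((Real.log (sepNum F n ε) / n : ℝ) : EReal)) Filter.atTop) ⟨δ, hδ⟩)
  refine Filter.le_limsup_of_frequently_le ?_ (by isBoundedDefault)
  refine (hfreq.and_eventually (eventually_ge_atTop m)).mono ?_
  rintro n ⟨h1, h2⟩
  exact EReal.coe_le_coe_iff.2
    (log_bound ha0' hm0 h2 hm.le (EReal.coe_lt_coe_iff.1 h1) (hcount n))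
end

section
/- Let f be a continuous self-map of the interval I = [0,1] that is topologically transitive. Then the induced map \bar f on the hyperspace K(I) has infinite topological entropy: h(\bar f) = ∞. -/
open Filter Topology TopologicalSpace

/-- Transitivity of a real map on an interval. -/
def TrOn (f : ℝ → ℝ) (a b : ℝ) : Prop :=
  ∀ U V : Set ℝ, IsOpen U → IsOpen V → (U ∩ Set.Ioo a b).Nonempty → (V ∩ Set.Ioo a b).Nonempty →
    ∃ n ≥ 1, ∃ x ∈ U ∩ Set.Ioo a b, f^[n] x ∈ V ∩ Set.Ioo a b

lemma tr_no_invariant {f : ℝ → ℝ} {a b c d m : ℝ} (h : TrOn f a b)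
    (hac : a ≤ c) (hcd : c < d) (hdb : d ≤ b)
    (hinv : Set.MapsTo f (Set.Icc c d) (Set.Icc c d)) (ham : a < m) (hmb : m < b)
    (hm : m ∉ Set.Icc c d) : False := by
  obtain ⟨n, -, x, ⟨hx, -⟩, hy, -⟩ := h (Set.Ioo c d) (Set.Icc c d)ᶜ isOpen_Ioo
    isClosed_Icc.isOpen_compl
    ⟨(c + d) / 2, ⟨by linarith, by linarith⟩, ⟨by linarith, by linarith⟩⟩ ⟨m, hm, ham, hmb⟩
  exact hy (hinv.iterate n (Set.Ioo_subset_Icc_self hx))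

lemma tr_fixed {f : ℝ → ℝ} {a b : ℝ} (hab : a < b) (hf : Continuous f)
    (hm : Set.MapsTo f (Set.Icc a b) (Set.Icc a b)) (h : TrOn f a b) :
    ∃ p ∈ Set.Ioo a b, f p = p := by
  by_cases h1 : ∃ x ∈ Set.Ioo a b, f x ≤ x
  · by_cases h2 : ∃ y ∈ Set.Ioo a b, y ≤ f y
    · obtain ⟨x, hx, hx'⟩ := h1
      obtain ⟨y, hy, hy'⟩ := h2
      exact isPreconnected_Ioo.intermediate_value₂ hx hy hf.continuousOn continuousOn_id hx' hy'
    · exfalso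
      push Not at h2
      have hcl : Set.Icc a b ⊆ {x | f x ≤ x} := by
        rw [← closure_Ioo hab.ne]
        exact closure_minimal (fun x hx => (h2 x hx).le) (isClosed_le hf continuous_id)
      refine tr_no_invariant (c := a) (d := (a + b) / 2) (m := (a + 3 * b) / 4) h le_rfl
        (by linarith) (by linarith) ?_ (by linarith) (by linarith) (fun hh => by linarith [hh.2])
      intro x hx
      have hx' : x ∈ Set.Icc a b := ⟨hx.1, by linarith [hx.2]⟩
      have h3 : f x ≤ x := hcl hx'
      exact ⟨(hm hx').1, h3.trans hx.2⟩
  · exfalso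
    push Not at h1
    have hcl : Set.Icc a b ⊆ {x | x ≤ f x} := by
      rw [← closure_Ioo hab.ne]
      exact closure_minimal (fun x hx => (h1 x hx).le) (isClosed_le continuous_id hf)
    refine tr_no_invariant (c := (a + b) / 2) (d := b) (m := (3 * a + b) / 4) h (by linarith)
      (by linarith) le_rfl ?_ (by linarith) (by linarith) (fun hh => by linarith [hh.1])
    intro x hx
    have hx' : x ∈ Set.Icc a b := ⟨by linarith [hx.1], hx.2⟩
    have h3 : x ≤ f x := hcl hx'
    exact ⟨hx.1.trans h3, (hm hx').2⟩

lemma tr_swap {f : ℝ → ℝ} {a b p : ℝ} (hf : Continuous f)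
    (hm : Set.MapsTo f (Set.Icc a b) (Set.Icc a b)) (h : TrOn f a b)
    (hp : p ∈ Set.Ioo a b) (hfp : f p = p) (hno : ∀ u ∈ Set.Ioo a b, u ≠ p → f u ≠ p) :
    (∀ x ∈ Set.Icc a p, p ≤ f x) ∧ (∀ x ∈ Set.Icc p b, f x ≤ p) := by
  obtain ⟨hap, hpb⟩ := hp
  constructor
  · by_cases h1 : ∃ x ∈ Set.Ioo a p, f x ≤ p
    · exfalso
      obtain ⟨x, hx, hx'⟩ := h1
      have h2 : ∀ y ∈ Set.Ioo a p, f y ≤ p := by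
        intro y hy
        by_contra hc
        obtain ⟨z, hz, hz'⟩ := isPreconnected_Ioo.intermediate_value₂ hx hy hf.continuousOn
          (continuousOn_const (c := p)) hx' (not_le.mp hc).le
        exact hno z ⟨hz.1, hz.2.trans hpb⟩ hz.2.ne hz'
      have hcl : Set.Icc a p ⊆ {x | f x ≤ p} := by
        rw [← closure_Ioo hap.ne]
        exact closure_minimal (fun x hx => (h2 x hx)) (isClosed_le hf continuous_const)
      refine tr_no_invariant (c := a) (d := p) (m := (p + b) / 2) h le_rfl
        (by linarith) (by linarith) ?_ (by linarith) (by linarith) (fun hh => by linarith [hh.2])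
      intro x hx
      exact ⟨(hm ⟨hx.1, hx.2.trans hpb.le⟩).1, hcl hx⟩
    · push Not at h1
      have hcl : Set.Icc a p ⊆ {x | p ≤ f x} := by
        rw [← closure_Ioo hap.ne]
        exact closure_minimal (fun x hx => (h1 x hx).le) (isClosed_le continuous_const hf)
      exact hcl
  · by_cases h1 : ∃ x ∈ Set.Ioo p b, p ≤ f x
    · exfalso
      obtain ⟨x, hx, hx'⟩ := h1
      have h2 : ∀ y ∈ Set.Ioo p b, p ≤ f y := by
        intro y hy
        by_contra hc
        obtain ⟨z, hz, hz'⟩ := isPreconnected_Ioo.intermediate_value₂ hy hx hf.continuousOn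
          (continuousOn_const (c := p)) (not_le.mp hc).le hx'
        exact hno z ⟨hap.trans hz.1, hz.2⟩ hz.1.ne' hz'
      have hcl : Set.Icc p b ⊆ {x | p ≤ f x} := by
        rw [← closure_Ioo hpb.ne]
        exact closure_minimal (fun x hx => (h2 x hx)) (isClosed_le continuous_const hf)
      refine tr_no_invariant (c := p) (d := b) (m := (a + p) / 2) h (by linarith)
        (by linarith) le_rfl ?_ (by linarith) (by linarith) (fun hh => by linarith [hh.1])
      intro x hx
      exact ⟨hcl hx, (hm ⟨hap.le.trans hx.1, hx.2⟩).2⟩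
    · push Not at h1
      have hcl : Set.Icc p b ⊆ {x | f x ≤ p} := by
        rw [← closure_Ioo hpb.ne]
        exact closure_minimal (fun x hx => (h1 x hx).le) (isClosed_le hf continuous_const)
      exact hcl

lemma uIcc_subset_image {f : ℝ → ℝ} (hf : Continuous f) {c d x y u v : ℝ}
    (hx : x ∈ Set.uIcc c d) (hy : y ∈ Set.uIcc c d) (hu : f x = u) (hv : f y = v) :
    Set.uIcc u v ⊆ f '' Set.uIcc c d := by
  have hc : (f '' Set.uIcc c d).OrdConnected :=
    (isPreconnected_uIcc.image f hf.continuousOn).ordConnected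
  exact hc.uIcc_subset ⟨x, hx, hu⟩ ⟨y, hy, hv⟩

lemma tr_cover {f : ℝ → ℝ} {a b p u c : ℝ} (hf : Continuous f)
    (h : TrOn f a b) (hp : p ∈ Set.Ioo a b) (hfp : f p = p) (hu : u ∈ Set.Ioo a b) (hup : u ≠ p)
    (hc : c ∈ Set.Icc a b) (hcp : c ≠ p) :
    ∃ n ≥ 1, Set.uIcc u p ⊆ f^[n] '' Set.uIcc p c := by
  have hU : ((Set.Ioo (min p c) (max p c)) ∩ Set.Ioo a b).Nonempty := by
    refine ⟨(p + c) / 2, ?_⟩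
    obtain ⟨h1, h2⟩ := hp
    obtain ⟨h3, h4⟩ := hc
    rcases lt_or_gt_of_ne hcp with h5 | h5
    · rw [min_eq_right h5.le, max_eq_left h5.le]
      refine ⟨⟨?_, ?_⟩, ?_, ?_⟩ <;> linarith
    · rw [min_eq_left h5.le, max_eq_right h5.le]
      refine ⟨⟨?_, ?_⟩, ?_, ?_⟩ <;> linarith
  have hfpn : ∀ n, f^[n] p = p := fun n => Function.iterate_fixed hfp n
  have key : ∃ V : Set ℝ, IsOpen V ∧ (V ∩ Set.Ioo a b).Nonempty ∧ ∀ v ∈ V, u ∈ Set.uIcc v p := by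
    rcases lt_or_gt_of_ne hup with h5 | h5
    · refine ⟨Set.Iio u, isOpen_Iio, ⟨(a + u) / 2, ?_⟩, ?_⟩
      · obtain ⟨h1, h2⟩ := hu
        refine ⟨Set.mem_Iio.mpr ?_, ?_, ?_⟩ <;> linarith
      · intro v hv
        exact Set.mem_uIcc.mpr (Or.inl ⟨(Set.mem_Iio.mp hv).le, h5.le⟩)
    · refine ⟨Set.Ioi u, isOpen_Ioi, ⟨(u + b) / 2, ?_⟩, ?_⟩
      · obtain ⟨h1, h2⟩ := hu
        refine ⟨Set.mem_Ioi.mpr ?_, ?_, ?_⟩ <;> linarith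
      · intro v hv
        exact Set.mem_uIcc.mpr (Or.inr ⟨h5.le, (Set.mem_Ioi.mp hv).le⟩)
  obtain ⟨V, hVo, hVn, hV⟩ := key
  obtain ⟨n, hn, x, ⟨hx, -⟩, hy, -⟩ := h _ V isOpen_Ioo hVo hU hVn
  refine ⟨n, hn, ?_⟩
  refine (Set.uIcc_subset_uIcc_right (hV _ hy)).trans ?_
  exact uIcc_subset_image (hf.iterate n) (Set.Ioo_subset_Icc_self hx) Set.left_mem_uIcc rfl (hfpn n)

/-- A horseshoe for some power of `f`, indexed by `ι`. -/
structure HS {X ι : Type*} [TopologicalSpace X] (g : X → X) (J : ι → Set X) : Prop where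
  closed : ∀ i, IsClosed (J i)
  nonempty : ∀ i, (J i).Nonempty
  disj : ∀ i j, i ≠ j → Disjoint (J i) (J j)
  cover : ∀ i j, J j ⊆ g '' J i

lemma cover_iterate {X : Type*} {g : X → X} {A : Set X} (h : A ⊆ g '' A) (n : ℕ) :
    A ⊆ g^[n] '' A := by
  induction n with
  | zero => simp
  | succ n ih =>
    rw [Function.iterate_succ', Set.image_comp]
    exact h.trans (Set.image_mono ih)

lemma cover_mul {X : Type*} {f : X → X} {A R : Set X} {m : ℕ} (hA : A ⊆ R) (h : R ⊆ f^[m] '' A)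
    {n : ℕ} (hn : 1 ≤ n) : R ⊆ f^[m * n] '' A := by
  obtain ⟨k, rfl⟩ := Nat.exists_eq_add_of_le' hn
  rw [Function.iterate_mul, Function.iterate_succ', Set.image_comp]
  exact h.trans (Set.image_mono (cover_iterate (hA.trans h) k))

lemma tr_horse_of_preimage {f : ℝ → ℝ} {a b p u : ℝ} (hf : Continuous f)
    (hm : Set.MapsTo f (Set.Icc a b) (Set.Icc a b))
    (h : TrOn f a b) (hp : p ∈ Set.Ioo a b) (hfp : f p = p) (hu : u ∈ Set.Ioo a b) (hup : u ≠ p)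
    (hfu : f u = p) :
    ∃ k ≥ 1, ∃ J : Bool → Set ℝ, HS f^[k] J ∧ ∀ i, J i ⊆ Set.Icc a b := by
  have hsub : ∀ {x}, x ∈ Set.uIcc u p → x ∈ Set.Ioo a b := by
    intro x hx
    exact Set.ordConnected_Ioo.uIcc_subset hu hp hx
  set v := (u + p) / 2 with hv
  set w := (u + 3 * p) / 4 with hw
  have hv1 : v ∈ Set.uIcc u p := by
    rw [Set.mem_uIcc]
    rcases lt_or_gt_of_ne hup with h5 | h5
    · left; constructor <;> linarith
    · right; constructor <;> linarith
  have hw1 : w ∈ Set.uIcc u p := by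
    rw [Set.mem_uIcc]
    rcases lt_or_gt_of_ne hup with h5 | h5
    · left; constructor <;> linarith
    · right; constructor <;> linarith
  have hwp : w ≠ p := by
    intro hc; apply hup; linarith
  have hpv : p ∉ Set.uIcc u v := by
    rw [Set.mem_uIcc]
    rcases lt_or_gt_of_ne hup with h5 | h5
    · rintro (h6 | h6) <;> linarith [h6.1, h6.2]
    · rintro (h6 | h6) <;> linarith [h6.1, h6.2]
  have hdisj : Disjoint (Set.uIcc u v) (Set.uIcc p w) := by
    rw [Set.disjoint_left]
    intro x hx hx'
    rw [Set.mem_uIcc] at hx hx'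
    rcases lt_or_gt_of_ne hup with h5 | h5
    · rcases hx with h6 | h6 <;> rcases hx' with h7 | h7 <;> linarith [h6.1, h6.2, h7.1, h7.2]
    · rcases hx with h6 | h6 <;> rcases hx' with h7 | h7 <;> linarith [h6.1, h6.2, h7.1, h7.2]
  obtain ⟨m, hm1, hm2⟩ := tr_cover hf h hp hfp hu hup (Set.Ioo_subset_Icc_self (hsub hw1)) hwp
  have hJ1 : Set.uIcc u v ⊆ Set.uIcc u p := Set.uIcc_subset_uIcc_left hv1
  have hJ0 : Set.uIcc p w ⊆ Set.uIcc u p := by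
    rw [Set.uIcc_comm u p]; rw [Set.uIcc_comm u p] at hw1; exact Set.uIcc_subset_uIcc_left hw1
  -- a point of the first interval not mapped to `p`
  have hex : ∃ x ∈ Set.uIcc u v, f x ≠ p := by
    by_contra hc
    push Not at hc
    have hne : (Set.Ioo (min u v) (max u v) ∩ Set.Ioo a b).Nonempty := by
      refine ⟨(u + v) / 2, ?_, hsub (hJ1 ?_)⟩
      · rcases lt_or_gt_of_ne hup with h5 | h5
        · have : u < v := by linarith
          rw [min_eq_left this.le, max_eq_right this.le]; constructor <;> linarith
        · have : v < u := by linarith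
          rw [min_eq_right this.le, max_eq_left this.le]; constructor <;> linarith
      · rw [Set.mem_uIcc]
        rcases lt_or_gt_of_ne hup with h5 | h5
        · left; constructor <;> linarith
        · right; constructor <;> linarith
    obtain ⟨n, hn, x, ⟨hx, -⟩, hy, -⟩ := h _ _ isOpen_Ioo isOpen_Ioo hne hne
    obtain ⟨k, rfl⟩ := Nat.exists_eq_add_of_le' hn
    rw [Function.iterate_succ_apply, hc x (Set.Ioo_subset_Icc_self hx),
      Function.iterate_fixed hfp] at hy
    exact hpv (Set.Ioo_subset_Icc_self hy)
  obtain ⟨x, hx, hfx⟩ := hex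
  have hfx1 : f x ∈ Set.Icc a b := hm (Set.Ioo_subset_Icc_self (hsub (hJ1 hx)))
  obtain ⟨n, hn1, hn2⟩ := tr_cover hf h hp hfp hu hup hfx1 hfx
  have hcov1 : Set.uIcc u p ⊆ f^[n + 1] '' Set.uIcc u v := by
    rw [Function.iterate_succ, Set.image_comp]
    exact hn2.trans (Set.image_mono (uIcc_subset_image hf Set.left_mem_uIcc hx hfu rfl))
  refine ⟨m * (n + 1), by nlinarith, fun i => if i then Set.uIcc u v else Set.uIcc p w,
    ⟨?_, ?_, ?_, ?_⟩, ?_⟩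
  · rintro (_ | _) <;> simp [Set.uIcc, isClosed_Icc]
  · rintro (_ | _) <;> simp [Set.nonempty_uIcc]
  · rintro (_ | _) (_ | _) <;> simp [hdisj, hdisj.symm]
  · have h0 := cover_mul hJ0 hm2 (n := n + 1) (by omega)
    have h1 := cover_mul hJ1 hcov1 hm1
    rw [mul_comm] at h1
    rintro (_ | _) (_ | _)
    · simpa using hJ0.trans h0
    · simpa using hJ1.trans h0
    · simpa using hJ0.trans h1
    · simpa using hJ1.trans h1
  · rintro (_ | _) x hx
    · exact Set.Ioo_subset_Icc_self (hsub (hJ0 (by simpa using hx)))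
    · exact Set.Ioo_subset_Icc_self (hsub (hJ1 (by simpa using hx)))

lemma tr_horse {f : ℝ → ℝ} {a b : ℝ} (hab : a < b) (hf : Continuous f)
    (hm : Set.MapsTo f (Set.Icc a b) (Set.Icc a b)) (h : TrOn f a b) :
    ∃ k ≥ 1, ∃ J : Bool → Set ℝ, HS f^[k] J ∧ ∀ i, J i ⊆ Set.Icc a b := by
  obtain ⟨p, hp, hfp⟩ := tr_fixed hab hf hm h
  by_cases hno : ∀ u ∈ Set.Ioo a b, u ≠ p → f u ≠ p
  swap
  · push Not at hno
    obtain ⟨u, hu, hup, hfu⟩ := hno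
    exact tr_horse_of_preimage hf hm h hp hfp hu hup hfu
  obtain ⟨hs1, hs2⟩ := tr_swap hf hm h hp hfp hno
  have hA : Set.MapsTo f (Set.Icc a p) (Set.Icc p b) := fun x hx =>
    ⟨hs1 x hx, (hm ⟨hx.1, hx.2.trans hp.2.le⟩).2⟩
  have hB : Set.MapsTo f (Set.Icc p b) (Set.Icc a p) := fun x hx =>
    ⟨(hm ⟨hp.1.le.trans hx.1, hx.2⟩).1, hs2 x hx⟩
  have hg : Continuous f^[2] := hf.iterate 2
  have hgm : Set.MapsTo f^[2] (Set.Icc a p) (Set.Icc a p) := hB.comp hA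
  have hgp : f^[2] p = p := Function.iterate_fixed hfp 2
  have hgt : TrOn f^[2] a p := by
    rintro U V hU hV ⟨x, hx, hx'⟩ ⟨y, hy, hy'⟩
    obtain ⟨n, hn, z, ⟨⟨hz, hz'⟩, -⟩, ⟨hw, hw'⟩, -⟩ := h (U ∩ Set.Ioo a p) (V ∩ Set.Ioo a p)
      (hU.inter isOpen_Ioo) (hV.inter isOpen_Ioo) ⟨x, ⟨hx, hx'⟩, hx'.1, hx'.2.trans hp.2⟩
      ⟨y, ⟨hy, hy'⟩, hy'.1, hy'.2.trans hp.2⟩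
    obtain ⟨m, rfl | rfl⟩ := Nat.even_or_odd' n
    · rw [Function.iterate_mul] at hw hw'
      exact ⟨m, by omega, z, ⟨hz, hz'⟩, hw, hw'⟩
    · exfalso
      rw [Function.iterate_succ_apply', Function.iterate_mul] at hw'
      have := hA (hgm.iterate m (Set.Ioo_subset_Icc_self hz'))
      linarith [this.1, hw'.2]
  obtain ⟨r, hr, hgr⟩ := tr_fixed hp.1 hg hgm hgt
  have hex : ∃ u ∈ Set.Ioo a p, u ≠ r ∧ f^[2] u = r := by
    by_contra hc
    push Not at hc
    have := (tr_swap hg hgm hgt hr hgr hc).2 p ⟨hr.2.le, le_rfl⟩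
    rw [hgp] at this
    linarith [hr.2]
  obtain ⟨u, hu, hur, hgu⟩ := hex
  obtain ⟨k, hk, J, hJ, hJs⟩ := tr_horse_of_preimage hg hgm hgt hr hgr hu hur hgu
  rw [← Function.iterate_mul] at hJ
  exact ⟨2 * k, by omega, J, hJ, fun i => (hJs i).trans (Set.Icc_subset_Icc_right hp.2.le)⟩

lemma horse_unit (f : Set.Icc (0 : ℝ) 1 → Set.Icc (0 : ℝ) 1) (hf : Continuous f)
    (htrans : ∀ U V : Set (Set.Icc (0 : ℝ) 1), IsOpen U → IsOpen V →
      U.Nonempty → V.Nonempty → ∃ n ≥ 1, (f^[n] '' U ∩ V).Nonempty) :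
    ∃ k ≥ 1, ∃ J : Bool → Set (Set.Icc (0 : ℝ) 1), HS f^[k] J := by
  set G : ℝ → ℝ := fun x => (f (Set.projIcc 0 1 zero_le_one x) : ℝ) with hG
  have hGc : Continuous G := continuous_subtype_val.comp (hf.comp continuous_projIcc)
  have hsemi : ∀ n (x : Set.Icc (0 : ℝ) 1), G^[n] (x : ℝ) = (f^[n] x : ℝ) := by
    intro n
    induction n with
    | zero => simp
    | succ n ih =>
      intro x
      rw [Function.iterate_succ_apply, Function.iterate_succ_apply, ← ih]
      simp [hG]
  obtain ⟨k, hk, J, hJ, hJs⟩ := tr_horse (f := G) zero_lt_one hGc (fun x _ => Subtype.mem _) (by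
    rintro U V hU hV ⟨x, hx, hx'⟩ ⟨y, hy, hy'⟩
    obtain ⟨n, hn, z, ⟨t, ht, htz⟩, hz⟩ := htrans (Subtype.val ⁻¹' (U ∩ Set.Ioo 0 1))
      (Subtype.val ⁻¹' (V ∩ Set.Ioo 0 1))
      ((hU.inter isOpen_Ioo).preimage continuous_subtype_val)
      ((hV.inter isOpen_Ioo).preimage continuous_subtype_val)
      ⟨⟨x, Set.Ioo_subset_Icc_self hx'⟩, hx, hx'⟩ ⟨⟨y, Set.Ioo_subset_Icc_self hy'⟩, hy, hy'⟩
    refine ⟨n, hn, t, ht, ?_⟩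
    rw [hsemi, htz]
    exact hz)
  refine ⟨k, hk, fun i => Subtype.val ⁻¹' J i, ?_, ?_, ?_, ?_⟩
  · exact fun i => (hJ.closed i).preimage continuous_subtype_val
  · intro i
    obtain ⟨x, hx⟩ := hJ.nonempty i
    exact ⟨⟨x, hJs i hx⟩, hx⟩
  · exact fun i j hij => (hJ.disj i j hij).preimage _
  · intro i j x hx
    obtain ⟨y, hy, hyx⟩ := hJ.cover i j hx
    refine ⟨⟨y, hJs i hy⟩, hy, ?_⟩
    apply Subtype.ext
    rw [← hsemi]
    exact hyx

lemma HS.path {X ι : Type*} [TopologicalSpace X] {g : X → X} {J : ι → Set X} (h : HS g J) (n : ℕ) :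
    ∀ (w : ℕ → ι), ∀ y ∈ J (w n), ∃ x, g^[n] x = y ∧ ∀ i ≤ n, g^[i] x ∈ J (w i) := by
  induction n with
  | zero =>
    intro w y hy
    refine ⟨y, rfl, fun i hi => ?_⟩
    obtain rfl : i = 0 := by omega
    exact hy
  | succ n ih =>
    intro w y hy
    obtain ⟨x, hx, hx'⟩ := ih (fun i => w (i + 1)) y hy
    obtain ⟨z, hz, rfl⟩ := h.cover (w 0) _ (hx' 0 (by omega))
    refine ⟨z, hx, fun i hi => ?_⟩
    cases i with
    | zero => exact hz
    | succ i => exact hx' i (by omega)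

lemma HS.power {X : Type*} [TopologicalSpace X] {g : X → X} (hg : Continuous g)
    {J : Bool → Set X} (h : HS g J) {L : ℕ} (hL : 1 ≤ L) :
    HS g^[L] (fun w : Fin L → Bool => {x | ∀ i : Fin L, g^[i] x ∈ J (w i)}) := by
  have key : ∀ (w : Fin L → Bool) (b : Bool), ∀ y ∈ J b,
      ∃ x, g^[L] x = y ∧ ∀ i : Fin L, g^[i] x ∈ J (w i) := by
    intro w b y hy
    obtain ⟨x, hx, hx'⟩ := h.path L (fun i => if hi : i < L then w ⟨i, hi⟩ else b) y (by simpa)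
    refine ⟨x, hx, fun i => ?_⟩
    simpa using hx' i i.2.le
  refine ⟨?_, ?_, ?_, ?_⟩
  · intro w
    simp only [Set.ofPred_forall]
    exact isClosed_iInter fun i => (h.closed _).preimage (hg.iterate _)
  · intro w
    obtain ⟨y, hy⟩ := h.nonempty true
    obtain ⟨x, -, hx⟩ := key w true y hy
    exact ⟨x, hx⟩
  · intro w w' hw
    obtain ⟨i, hi⟩ := Function.ne_iff.mp hw
    rw [Set.disjoint_left]
    intro x hx hx'
    exact Set.disjoint_left.mp (h.disj _ _ hi) (hx i) (hx' i)
  · intro w w' y hy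
    obtain ⟨x, hx, hx'⟩ := key w _ y (hy ⟨0, hL⟩)
    exact ⟨x, hx', hx⟩

lemma HS.sep {X ι : Type*} [MetricSpace X] [CompactSpace X] [Finite ι] {g : X → X} {J : ι → Set X}
    (h : HS g J) : ∃ ε : ℝ, 0 < ε ∧ ∀ i j, i ≠ j → ∀ x ∈ J i, ∀ y ∈ J j, ε < dist x y := by
  have h1 : ∀ q : ι × ι, ∃ r : ℝ, 0 < r ∧ (q.1 ≠ q.2 → ∀ x ∈ J q.1, ∀ y ∈ J q.2, r < dist x y) := by
    rintro ⟨i, j⟩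
    by_cases hij : i = j
    · exact ⟨1, one_pos, fun hh => (hh hij).elim⟩
    · obtain ⟨r, hr, hr'⟩ := Metric.exists_pos_forall_lt_edist (h.closed i).isCompact (h.closed j)
        (h.disj i j hij)
      refine ⟨r, hr, fun _ x hx y hy => ?_⟩
      have := hr' x hx y hy
      rw [edist_nndist] at this
      exact_mod_cast this
  choose r hr hr' using h1
  rcases isEmpty_or_nonempty ι with he | he
  · exact ⟨1, one_pos, fun i => he.elim i⟩
  obtain ⟨q, hq⟩ := Finite.exists_min r
  exact ⟨r q, hr q, fun i j hij x hx y hy => (hq (i, j)).trans_lt (hr' (i, j) hij x hx y hy)⟩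

lemma sepNum_ge {Y : Type*} [MetricSpace Y] [CompactSpace Y] (F : ℕ → Y → Y) (n : ℕ) {ε : ℝ}
    (hε : 0 < ε) (E : Finset Y) (hE : IsSeparated F n ε ↑E) : E.card ≤ sepNum F n ε := by
  classical
  unfold sepNum
  refine le_csSup ?_ ⟨E, hE, rfl⟩
  obtain ⟨t, htf, ht⟩ := Metric.totallyBounded_iff.mp
    (isCompact_univ (X := Y)).totallyBounded (ε / 2) (by linarith)
  have h1 : ∀ y : Y, ∃ c : t, dist y c < ε / 2 := by
    intro y
    obtain ⟨c, hc, hc'⟩ := Set.mem_iUnion₂.mp (ht (Set.mem_univ y))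
    exact ⟨⟨c, hc⟩, hc'⟩
  choose c hc using h1
  haveI := htf.fintype
  refine ⟨Fintype.card (Fin n → t), ?_⟩
  rintro m ⟨D, hD, rfl⟩
  rw [← Fintype.card_coe D]
  refine Fintype.card_le_of_injective (fun (y : D) (k : Fin n) => c (comps F k (y : Y))) ?_
  intro x y hxy
  by_contra hne
  obtain ⟨k, hk, hd⟩ := hD x x.2 y y.2 (fun hh => hne (Subtype.ext hh))
  have h2 : c (comps F k (x : Y)) = c (comps F k (y : Y)) := congrFun hxy ⟨k, hk⟩
  have h3 := hc (comps F k (x : Y))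
  have h4 := hc (comps F k (y : Y))
  rw [← h2, dist_comm] at h4
  linarith [dist_triangle (comps F k (x : Y)) (c (comps F k (x : Y))) (comps F k (y : Y)),
    dist_comm (comps F k (x : Y)) (c (comps F k (x : Y)))]

lemma comps_coe {X : Type*} [MetricSpace X] {f : X → X}
    {F : NonemptyCompacts X → NonemptyCompacts X} (hF : ∀ K, (F K : Set X) = f '' ↑K) (n : ℕ)
    (K : NonemptyCompacts X) : ((comps (fun _ => F) n K : NonemptyCompacts X) : Set X) = f^[n] '' ↑K := by
  induction n with
  | zero => simp [comps]
  | succ n ih =>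
    show (F (comps (fun _ => F) n K) : Set X) = _
    rw [hF, ih, Function.iterate_succ', Set.image_comp]

lemma lt_dist_of {X : Type*} [MetricSpace X] {A B : NonemptyCompacts X} {ε : ℝ} {x : X}
    (hx : x ∈ (A : Set X)) (hB : ∀ y ∈ (B : Set X), ε < dist x y) : ε < dist A B := by
  obtain ⟨y, hy, hxy⟩ := B.isCompact.exists_infDist_eq_dist B.nonempty x
  have h1 : Metric.infDist x (B : Set X) ≤ Metric.hausdorffDist (A : Set X) B :=
    Metric.infDist_le_hausdorffDist_of_mem hx
      (Metric.hausdorffEDist_ne_top_of_nonempty_of_bounded A.nonempty B.nonempty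
        A.isCompact.isBounded B.isCompact.isBounded)
  rw [Metric.NonemptyCompacts.dist_eq]
  linarith [hB y hy]

lemma HS.count {X ι : Type*} [MetricSpace X] [CompactSpace X] [Fintype ι] [Nonempty ι]
    {f : X → X} (hf : Continuous f) {k : ℕ} (hk : 1 ≤ k) {J : ι → Set X} (h : HS f^[k] J)
    {F : NonemptyCompacts X → NonemptyCompacts X} (hF : ∀ K, (F K : Set X) = f '' ↑K) :
    ∃ ε : ℝ, 0 < ε ∧ ∀ N, (2 ^ Fintype.card ι - 1) ^ N ≤ sepNum (fun _ => F) (k * N) ε := by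
  classical
  obtain ⟨ε, hε, hsep⟩ := h.sep
  refine ⟨ε, hε, fun N => ?_⟩
  let T := {S : Finset ι // S ≠ ∅}
  let A : (Fin N → T) → Set X := fun S => {x | ∀ i : Fin N, ∃ j ∈ (S i).1, (f^[k])^[i] x ∈ J j}
  have hAc : ∀ S, IsClosed (A S) := by
    intro S
    have : A S = ⋂ i : Fin N, (f^[k])^[i] ⁻¹' (⋃ j ∈ (S i).1, J j) := by
      ext x; simp [A]
    rw [this]
    refine isClosed_iInter fun i => IsClosed.preimage ((hf.iterate k).iterate i) ?_
    exact isClosed_biUnion_finset fun j _ => h.closed j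
  have hpt : ∀ S : Fin N → T, ∀ i : Fin N, ∀ j ∈ (S i).1, ∃ x ∈ A S, (f^[k])^[i] x ∈ J j := by
    intro S i j hj
    have hch : ∀ m : Fin N, ∃ l, l ∈ (S m).1 := fun m => Finset.nonempty_iff_ne_empty.mpr (S m).2
    choose w hw using hch
    obtain ⟨y, hy⟩ := h.nonempty (if hm : N < N then (Function.update w i j) ⟨N, hm⟩ else j)
    obtain ⟨x, -, hx⟩ := h.path N
      (fun m => if hm : m < N then (Function.update w i j) ⟨m, hm⟩ else j) y hy
    refine ⟨x, fun m => ?_, ?_⟩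
    · refine ⟨Function.update w i j m, ?_, by simpa using hx m m.2.le⟩
      by_cases hmi : m = i
      · subst hmi; simpa using hj
      · simpa [hmi] using hw m
    · simpa using hx i i.2.le
  have hAn : ∀ S, (A S).Nonempty := by
    intro S
    rcases Nat.eq_zero_or_pos N with h0 | h0
    · subst h0
      obtain ⟨x, _⟩ := h.nonempty (Classical.arbitrary ι)
      exact ⟨x, fun i => i.elim0⟩
    · obtain ⟨j, hj⟩ := Finset.nonempty_iff_ne_empty.mpr (S ⟨0, h0⟩).2
      obtain ⟨x, hx, -⟩ := hpt S ⟨0, h0⟩ j hj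
      exact ⟨x, hx⟩
  let Φ : (Fin N → T) → NonemptyCompacts X := fun S => ⟨⟨A S, (hAc S).isCompact⟩, hAn S⟩
  have hΦ : ∀ S, (Φ S : Set X) = A S := fun S => rfl
  have key : ∀ S S' : Fin N → T, ∀ i : Fin N, ∀ j ∈ (S i).1, j ∉ (S' i).1 →
      ε < dist (comps (fun _ => F) (k * i) (Φ S)) (comps (fun _ => F) (k * i) (Φ S')) := by
    intro S S' i j hj hj'
    obtain ⟨x, hx, hxj⟩ := hpt S i j hj
    refine lt_dist_of (x := (f^[k])^[i] x) ?_ ?_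
    · rw [comps_coe hF, Function.iterate_mul, hΦ]
      exact ⟨x, hx, rfl⟩
    · rw [comps_coe hF, Function.iterate_mul, hΦ]
      rintro _ ⟨y, hy, rfl⟩
      obtain ⟨l, hl, hyl⟩ := hy i
      exact hsep j l (fun hjl => hj' (hjl ▸ hl)) _ hxj _ hyl
  have key2 : ∀ S S' : Fin N → T, S ≠ S' → ∃ m < k * N,
      ε < dist (comps (fun _ => F) m (Φ S)) (comps (fun _ => F) m (Φ S')) := by
    intro S S' hS
    obtain ⟨i, hi⟩ := Function.ne_iff.mp hS
    refine ⟨k * i, Nat.mul_lt_mul_of_pos_left i.2 hk, ?_⟩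
    by_cases hss : (S i).1 ⊆ (S' i).1
    · have : ¬ (S' i).1 ⊆ (S i).1 := fun hh => hi (Subtype.ext (hss.antisymm hh))
      obtain ⟨j, hj, hj'⟩ := Finset.not_subset.mp this
      rw [dist_comm]
      exact key S' S i j hj hj'
    · obtain ⟨j, hj, hj'⟩ := Finset.not_subset.mp hss
      exact key S S' i j hj hj'
  have hinj : Function.Injective Φ := by
    intro S S' hSS
    by_contra hne
    obtain ⟨m, -, hm⟩ := key2 S S' hne
    rw [hSS, dist_self] at hm
    linarith
  have hcard : (Finset.univ.image Φ).card = (2 ^ Fintype.card ι - 1) ^ N := by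
    rw [Finset.card_image_of_injective _ hinj, Finset.card_univ, Fintype.card_fun, Fintype.card_fin]
    congr 1
    have : Fintype.card T = Fintype.card (Finset ι) - 1 := Set.card_ne_eq (∅ : Finset ι)
    rw [this, Fintype.card_finset]
  rw [← hcard]
  refine sepNum_ge _ _ hε _ ?_
  intro x hx y hy hxy
  simp only [Finset.coe_image, Finset.coe_univ, Set.image_univ, Set.mem_range] at hx hy
  obtain ⟨S, rfl⟩ := hx
  obtain ⟨S', rfl⟩ := hy
  exact key2 S S' (fun hh => hxy (hh ▸ rfl))

lemma sq_lt_two_pow (L : ℕ) (hL : 5 ≤ L) : L ^ 2 + 1 ≤ 2 ^ L := by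
  induction L, hL using Nat.le_induction with
  | base => norm_num
  | succ n hn ih => rw [pow_succ 2 n]; nlinarith

lemma entropy_of_HS {X : Type*} [MetricSpace X] [CompactSpace X]
    {f : X → X} (hf : Continuous f) {k : ℕ} (hk : 1 ≤ k) {J : Bool → Set X} (h : HS f^[k] J)
    {F : NonemptyCompacts X → NonemptyCompacts X} (hF : ∀ K, (F K : Set X) = f '' ↑K) :
    sepEntropy (fun _ => F) = ⊤ := by
  rw [EReal.eq_top_iff_forall_lt]
  intro B
  have hlog : 0 < Real.log 2 := Real.log_pos one_lt_two
  have hk' : (0 : ℝ) < k := by exact_mod_cast hk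
  obtain ⟨L0, hL0⟩ := exists_nat_gt (k * B / Real.log 2)
  set L := max L0 5 with hLdef
  have hL5 : 5 ≤ L := le_max_right _ _
  have hLB : B < L * Real.log 2 / k := by
    rw [lt_div_iff₀ hk', ← div_lt_iff₀ hlog]
    have : (L0 : ℝ) ≤ L := by exact_mod_cast le_max_left _ _
    rw [mul_comm]
    linarith
  have hp := h.power (hf.iterate k) (L := L) (by omega)
  rw [← Function.iterate_mul] at hp
  obtain ⟨ε, hε, hcount⟩ := hp.count hf (Nat.mul_pos hk (by omega)) hF
  have hLpos : (0 : ℝ) < L := by exact_mod_cast (by omega : 0 < L)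
  have hbase : 2 ^ (L ^ 2) ≤ 2 ^ Fintype.card (Fin L → Bool) - 1 := by
    have h1 : Fintype.card (Fin L → Bool) = 2 ^ L := by simp
    rw [h1]
    have h2 : 2 ^ (L ^ 2 + 1) ≤ 2 ^ (2 ^ L) := Nat.pow_le_pow_right (by norm_num) (sq_lt_two_pow L hL5)
    have h3 : 1 ≤ 2 ^ (L ^ 2) := Nat.one_le_two_pow
    rw [pow_succ] at h2
    omega
  have hN : ∀ N : ℕ, 1 ≤ N → L * Real.log 2 / k ≤
      Real.log (sepNum (fun _ => F) (k * L * N) ε) / ((k * L * N : ℕ) : ℝ) := by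
    intro N hN
    have hNpos : (0 : ℝ) < N := by exact_mod_cast hN
    have h1 : (2 ^ (L ^ 2)) ^ N ≤ sepNum (fun _ => F) (k * L * N) ε :=
      (Nat.pow_le_pow_left hbase N).trans (hcount N)
    have h2 : ((2 : ℝ) ^ (L ^ 2)) ^ N ≤ sepNum (fun _ => F) (k * L * N) ε := by exact_mod_cast h1
    have h3 := Real.log_le_log (by positivity) h2
    rw [Real.log_pow, Real.log_pow] at h3
    push_cast at h3 ⊢
    rw [div_le_div_iff₀ hk' (by positivity)]
    calc (L : ℝ) * Real.log 2 * (k * L * N) = (N * (L ^ 2 * Real.log 2)) * k := by ring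
      _ ≤ _ := by gcongr
  calc (B : EReal) < ((L * Real.log 2 / k : ℝ) : EReal) := by exact_mod_cast hLB
    _ ≤ limsup (fun n : ℕ => ((Real.log (sepNum (fun _ => F) n ε) / n : ℝ) : EReal)) atTop := by
      refine le_limsup_of_frequently_le ?_
      rw [frequently_atTop]
      intro n0
      refine ⟨k * L * (n0 + 1), ?_, ?_⟩
      · have : 1 ≤ k * L := Nat.mul_pos hk (by omega)
        nlinarith
      · exact EReal.coe_le_coe_iff.mpr (hN (n0 + 1) (by omega))
    _ ≤ _ := le_iSup (fun ε : {e : ℝ // 0 < e} =>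
        limsup (fun n : ℕ => ((Real.log (sepNum (fun _ => F) n ε) / n : ℝ) : EReal)) atTop) ⟨ε, hε⟩

/-- If `f : [0,1] → [0,1]` is a continuous topologically transitive map, then the
induced map `\bar f` on the hyperspace `K([0,1])` of nonempty compact subsets (with
the Hausdorff metric) has infinite topological entropy. Here `F` is the induced map,
characterized by `F K = f '' K` as subsets of `[0,1]`. -/
theorem sepEntropy_hyperspace_of_transitive_interval
    (f : Set.Icc (0 : ℝ) 1 → Set.Icc (0 : ℝ) 1) (hf : Continuous f)
    (htrans : ∀ U V : Set (Set.Icc (0 : ℝ) 1), IsOpen U → IsOpen V →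
      U.Nonempty → V.Nonempty → ∃ n ≥ 1, (f^[n] '' U ∩ V).Nonempty)
    (F : NonemptyCompacts (Set.Icc (0 : ℝ) 1) → NonemptyCompacts (Set.Icc (0 : ℝ) 1))
    (hF : ∀ K, (F K : Set (Set.Icc (0 : ℝ) 1)) = f '' ↑K) :
    sepEntropy (fun _ => F) = ⊤ := by
  obtain ⟨k, hk, J, hJ⟩ := horse_unit f hf htrans
  exact entropy_of_HS hf hk hJ hF
end

section
/- There exists a sequence f_{0,∞} = {f_n}_{n=0}^∞ of continuous self-maps of I = [0,1] such that the non-autonomous dynamical system (I, f_{0,∞}) is topologically transitive, but the induced hyperspace system (K(I), \bar f_{0,∞}) has zero topological entropy: h(\bar f_{0,∞}) = 0. -/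
open Filter Topology TopologicalSpace

/-- The power map on the unit interval. -/
noncomputable def pw (a : ℝ) (x : Set.Icc (0 : ℝ) 1) : Set.Icc (0 : ℝ) 1 :=
  Set.projIcc 0 1 zero_le_one ((x : ℝ) ^ a)

lemma pw_coe {a : ℝ} (ha : 0 ≤ a) (x : Set.Icc (0 : ℝ) 1) : (pw a x : ℝ) = (x : ℝ) ^ a := by
  unfold pw
  rw [Set.projIcc_of_mem zero_le_one
    ⟨Real.rpow_nonneg x.2.1 a, Real.rpow_le_one x.2.1 x.2.2 ha⟩]

lemma pw_cont {a : ℝ} (ha : 0 ≤ a) : Continuous (pw a) :=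
  continuous_projIcc.comp ((Real.continuous_rpow_const ha).comp continuous_subtype_val)

lemma pw_pw {a b : ℝ} (ha : 0 ≤ a) (hb : 0 ≤ b) (x : Set.Icc (0 : ℝ) 1) :
    pw b (pw a x) = pw (a * b) x := by
  apply Subtype.ext
  rw [pw_coe hb, pw_coe ha, pw_coe (mul_nonneg ha hb), Real.rpow_mul x.2.1]

lemma pw_one (x : Set.Icc (0 : ℝ) 1) : pw 1 x = x := by
  apply Subtype.ext
  rw [pw_coe zero_le_one, Real.rpow_one]

lemma pw_trans (U V : Set (Set.Icc (0 : ℝ) 1)) (hU : IsOpen U) (hV : IsOpen V)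
    (hUn : U.Nonempty) (hVn : V.Nonempty) :
    ∃ q : {q : ℚ // 0 < q}, (pw ((q : ℚ) : ℝ) '' U ∩ V).Nonempty := by
  have key : ∀ W : Set (Set.Icc (0 : ℝ) 1), IsOpen W → W.Nonempty →
      ∃ x ∈ W, 0 < (x : ℝ) ∧ (x : ℝ) < 1 := by
    intro W hW hWn
    have hd : Dense ((Set.univ : Set (Set.Icc (0 : ℝ) 1)) \ {0, 1}) :=
      dense_univ.sdiff_finite (by simp)
    obtain ⟨x, hx, -, hx'⟩ := hd.inter_open_nonempty W hW hWn
    simp only [Set.mem_insert_iff, Set.mem_singleton_iff, not_or] at hx'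
    refine ⟨x, hx, lt_of_le_of_ne x.2.1 fun h => hx'.1 (Subtype.ext h.symm),
      lt_of_le_of_ne x.2.2 fun h => hx'.2 (Subtype.ext h)⟩
  obtain ⟨x, hxU, hx0, hx1⟩ := key U hU hUn
  obtain ⟨y, hyV, hy0, hy1⟩ := key V hV hVn
  have hc : Continuous (fun a : ℝ => pw a x) :=
    continuous_projIcc.comp (Real.continuous_const_rpow hx0.ne')
  have ho : IsOpen (((fun a : ℝ => pw a x) ⁻¹' V) ∩ Set.Ioi 0) :=
    (hV.preimage hc).inter isOpen_Ioi
  have hlx := Real.log_neg hx0 hx1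
  have hly := Real.log_neg hy0 hy1
  have hpos : 0 < Real.log y / Real.log x := div_pos_of_neg_of_neg hly hlx
  have hmem : pw (Real.log y / Real.log x) x = y := by
    apply Subtype.ext
    rw [pw_coe hpos.le, Real.rpow_def_of_pos hx0, mul_div_cancel₀ _ hlx.ne, Real.exp_log hy0]
  obtain ⟨q, hq1, hq2⟩ := Rat.denseRange_cast.exists_mem_open ho
    ⟨Real.log y / Real.log x, by simpa [hmem] using hyV, hpos⟩
  exact ⟨⟨q, Rat.cast_pos.1 (Set.mem_Ioi.1 hq2)⟩, pw q x, ⟨x, hxU, rfl⟩, hq1⟩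

/-- Uniform bound on the size of sets separated by finitely many continuous maps. -/
lemma sep_bound {X : Type*} [MetricSpace X] [CompactSpace X] (G : ℕ → X → X)
    (hG : ∀ i, Continuous (G i)) (m : ℕ) {ε : ℝ} (hε : 0 < ε) :
    ∃ C : ℕ, ∀ E : Finset X,
      (∀ x ∈ E, ∀ y ∈ E, x ≠ y → ∃ i ≤ m, ε < dist (G i x) (G i y)) → E.card ≤ C := by
  have h : ∀ x : X, ∃ W ∈ 𝓝 x, ∀ y ∈ W, ∀ i ≤ m, dist (G i y) (G i x) < ε / 2 := by
    intro x
    have : ∀ᶠ y in 𝓝 x, ∀ i ∈ Finset.range (m + 1), dist (G i y) (G i x) < ε / 2 := by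
      rw [Filter.eventually_all_finset]
      intro i _
      exact Metric.tendsto_nhds.1 ((hG i).tendsto x) _ (half_pos hε)
    exact ⟨_, this, fun y hy i hi => hy i (Finset.mem_range.2 (by omega))⟩
  choose W hW hW2 using h
  obtain ⟨t, ht⟩ := finite_cover_nhds hW
  refine ⟨t.card, fun E hE => ?_⟩
  have hc : ∀ x : X, ∃ z ∈ t, x ∈ W z := by
    intro x
    have : x ∈ ⋃ z ∈ t, W z := by rw [ht]; trivial
    simpa using this
  choose c hct hcW using hc
  refine Finset.card_le_card_of_injOn c (fun x _ => hct x) ?_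
  intro x hx y hy hxy
  by_contra hne
  obtain ⟨i, hi, hd⟩ := hE x hx y hy hne
  have h1 := hW2 _ x (hcW x) i hi
  have h2 := hW2 _ y (hcW y) i hi
  rw [← hxy] at h2
  have := dist_triangle_right (G i x) (G i y) (G i (c x))
  linarith

/-- Slow clock. -/
lemma exists_clock (N : ℕ → ℕ) : ∃ (s : ℕ → ℕ) (n₀ : ℕ), s 0 = 0 ∧ Monotone s ∧
    (∀ m, ∃ n ≥ 1, s n = m) ∧ (∀ n ≥ n₀, N (s n) ≤ n) := by
  let t : ℕ → ℕ := fun m => ∑ i ∈ Finset.range (m + 1), (N i + 1)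
  have hts : ∀ m, t (m + 1) = t m + (N (m + 1) + 1) := fun m => Finset.sum_range_succ _ _
  have ht : StrictMono t := strictMono_nat_of_lt_succ fun m => by rw [hts]; omega
  have hN : ∀ m, N m ≤ t m := by
    intro m
    cases m with
    | zero => simp [t]
    | succ m => rw [hts]; omega
  have ht0 : 1 ≤ t 0 := by simp [t]
  refine ⟨fun n => Nat.findGreatest (fun m => t m ≤ n) n, t 0, by simp, ?_, ?_, ?_⟩
  · intro a b hab
    exact Nat.findGreatest_mono (fun m (hm : t m ≤ a) => hm.trans hab) hab
  · intro m
    refine ⟨t m, ht0.trans (ht.monotone (Nat.zero_le m)), ?_⟩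
    apply le_antisymm
    · have := Nat.findGreatest_spec (P := fun k => t k ≤ t m) (ht.le_apply (x := m)) le_rfl
      exact ht.le_iff_le.1 this
    · exact Nat.le_findGreatest ht.le_apply le_rfl
  · intro n hn
    have := Nat.findGreatest_spec (P := fun k => t k ≤ n) (Nat.zero_le n) hn
    exact (hN _).trans this

lemma entropy_zero {X : Type*} [MetricSpace X] (F : ℕ → X → X)
    (hb : ∀ ε : ℝ, 0 < ε → ∃ b : ℕ → ℝ, Tendsto b atTop (𝓝 0) ∧
      ∀ᶠ n in atTop, Real.log (sepNum F n ε) / n ≤ b n) : sepEntropy F = 0 := by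
  unfold sepEntropy
  have : ∀ ε : {e : ℝ // 0 < e},
      Filter.limsup (fun n : ℕ => ((Real.log (sepNum F n ε) / n : ℝ) : EReal)) Filter.atTop = 0 := by
    intro ε
    obtain ⟨b, hb0, hb1⟩ := hb ε ε.2
    have ht : Tendsto (fun n : ℕ => Real.log (sepNum F n ε) / n) atTop (𝓝 0) :=
      tendsto_of_tendsto_of_tendsto_of_le_of_le' tendsto_const_nhds hb0
        (Eventually.of_forall fun n => div_nonneg (Real.log_natCast_nonneg _) (Nat.cast_nonneg _)) hb1
    exact ((continuous_coe_real_ereal.tendsto 0).comp ht).limsup_eq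
  have hne : Nonempty {e : ℝ // 0 < e} := ⟨⟨1, one_pos⟩⟩
  rw [iSup_congr this, ciSup_const]

/-- There exists a sequence of continuous self-maps of `[0,1]` whose non-autonomous
system is topologically transitive, while the induced hyperspace system on
`K([0,1])` (nonempty compact subsets with the Hausdorff metric) has zero topological
entropy. Here `F n` is the induced map, characterized by `F n K = f n '' K`. -/
theorem exists_transitive_NDS_with_zero_hyperspace_entropy :
    ∃ f : ℕ → Set.Icc (0 : ℝ) 1 → Set.Icc (0 : ℝ) 1,
      (∀ n, Continuous (f n)) ∧
      (∀ U V : Set (Set.Icc (0 : ℝ) 1), IsOpen U → IsOpen V →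
        U.Nonempty → V.Nonempty → ∃ n ≥ 1, (comps f n '' U ∩ V).Nonempty) ∧
      ∃ F : ℕ → NonemptyCompacts (Set.Icc (0 : ℝ) 1) →
            NonemptyCompacts (Set.Icc (0 : ℝ) 1),
        (∀ n K, (F n K : Set (Set.Icc (0 : ℝ) 1)) = f n '' ↑K) ∧
        sepEntropy F = 0 := by
  obtain ⟨q, hq⟩ := exists_surjective_nat {q : ℚ // 0 < q}
  let e : ℕ → ℝ := fun n => Nat.casesOn n 1 (fun k => ((q k : ℚ) : ℝ))
  have he : ∀ n, 0 < e n := by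
    intro n
    cases n with
    | zero => exact one_pos
    | succ k => exact Rat.cast_pos.2 (q k).2
  let G : ℕ → NonemptyCompacts (Set.Icc (0 : ℝ) 1) → NonemptyCompacts (Set.Icc (0 : ℝ) 1) :=
    fun i => NonemptyCompacts.map (pw (e i)) (pw_cont (he i).le)
  have hG : ∀ i, Continuous (G i) := fun i => Continuous.nonemptyCompacts_map (pw_cont (he i).le)
  have hC := fun m : ℕ => sep_bound G hG m (ε := 1 / ((m : ℝ) + 1)) (by positivity)
  choose C hC using hC
  obtain ⟨s, n₀, hs0, hsm, hss, hsN⟩ := exists_clock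
    (fun m => ⌈((m : ℝ) + 1) * Real.log (C m)⌉₊)
  have hr : ∀ n, 0 ≤ e (s (n + 1)) / e (s n) := fun n => (div_pos (he _) (he _)).le
  let f : ℕ → Set.Icc (0 : ℝ) 1 → Set.Icc (0 : ℝ) 1 := fun n => pw (e (s (n + 1)) / e (s n))
  have hf : ∀ n, Continuous (f n) := fun n => pw_cont (hr n)
  have hcomp : ∀ n x, comps f n x = pw (e (s n)) x := by
    intro n
    induction n with
    | zero =>
      intro x
      rw [hs0]
      exact (pw_one x).symm
    | succ n ih =>
      intro x
      change pw (e (s (n + 1)) / e (s n)) (comps f n x) = _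
      rw [ih, pw_pw (he _).le (hr n), mul_div_cancel₀ _ (he _).ne']
  have hst : Tendsto s atTop atTop := by
    refine tendsto_atTop_atTop.2 fun m => ?_
    obtain ⟨n, -, hn⟩ := hss m
    exact ⟨n, fun a ha => hn ▸ hsm ha⟩
  refine ⟨f, hf, ?_, fun n => NonemptyCompacts.map (f n) (hf n), fun n K => rfl, ?_⟩
  · intro U V hU hV hUn hVn
    obtain ⟨r, hr⟩ := pw_trans U V hU hV hUn hVn
    obtain ⟨k, rfl⟩ := hq r
    obtain ⟨n, hn1, hn⟩ := hss (k + 1)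
    refine ⟨n, hn1, ?_⟩
    have : comps f n = pw ((q k : ℚ) : ℝ) := by
      funext x
      rw [hcomp, hn]
    rw [this]
    exact hr
  · set F : ℕ → NonemptyCompacts (Set.Icc (0 : ℝ) 1) → NonemptyCompacts (Set.Icc (0 : ℝ) 1) :=
      fun n => NonemptyCompacts.map (f n) (hf n) with hF
    have hFs : ∀ n K, ((comps F n K : NonemptyCompacts (Set.Icc (0 : ℝ) 1)) : Set (Set.Icc (0 : ℝ) 1)) = comps f n '' K := by
      intro n
      induction n with
      | zero => intro K; exact (Set.image_id _).symm
      | succ n ih =>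
        intro K
        change f n '' ((comps F n K : NonemptyCompacts (Set.Icc (0 : ℝ) 1)) : Set (Set.Icc (0 : ℝ) 1)) = (f n ∘ comps f n) '' K
        rw [ih, Set.image_comp]
    have hFG : ∀ n K, comps F n K = G (s n) K := by
      intro n K
      apply SetLike.coe_injective
      rw [hFs, funext (hcomp n)]
      rfl
    apply entropy_zero
    intro ε hε
    refine ⟨fun n => 1 / ((s n : ℝ) + 1),
      (tendsto_one_div_add_atTop_nhds_zero_nat (𝕜 := ℝ)).comp hst, ?_⟩
    have hsmall : ∀ᶠ n in atTop, 1 / ((s n : ℝ) + 1) < ε :=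
      ((tendsto_one_div_add_atTop_nhds_zero_nat (𝕜 := ℝ)).comp hst).eventually_lt_const hε
    filter_upwards [hsmall, eventually_ge_atTop n₀, eventually_gt_atTop 0] with n h1 h2 h3
    have hle : sepNum F n ε ≤ C (s n) := by
      apply csSup_le'
      rintro m ⟨E, hE, rfl⟩
      apply hC
      intro x hx y hy hxy
      obtain ⟨k, hk, hd⟩ := hE x hx y hy hxy
      rw [hFG, hFG] at hd
      exact ⟨s k, hsm hk.le, h1.trans hd⟩
    have hlog : Real.log (sepNum F n ε) ≤ Real.log (C (s n)) := by
      rcases Nat.eq_zero_or_pos (sepNum F n ε) with h | h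
      · rw [h]; simpa using Real.log_natCast_nonneg _
      · exact Real.log_le_log (by exact_mod_cast h) (by exact_mod_cast hle)
    have hN : ((s n : ℝ) + 1) * Real.log (C (s n)) ≤ n :=
      (Nat.le_ceil _).trans (by exact_mod_cast hsN n h2)
    have hn : (0 : ℝ) < n := by exact_mod_cast h3
    rw [div_le_div_iff₀ hn (by positivity), one_mul, mul_comm]
    exact (mul_le_mul_of_nonneg_left hlog (by positivity)).trans hN
end

section
/- Let (X, f_{0,∞}) be a non-autonomous dynamical system on a compact metric space and n ≥ 1. If the induced hyperspace system (K(X), \bar f_{0,∞}) is chain weakly mixing of order n, then (X, f_{0,∞}) is chain weakly mixing of order n. -/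
open Filter Topology TopologicalSpace

/-- `{c 0, c 1, …, c m}` is an `ε`-chain of the non-autonomous system `f`:
`dist (f i (c i)) (c (i+1)) < ε` for all `i < m`. -/
def IsEpsChain {X : Type*} [MetricSpace X] (f : ℕ → X → X) (ε : ℝ) (c : ℕ → X) (m : ℕ) : Prop :=
  ∀ i < m, dist (f i (c i)) (c (i + 1)) < ε

/-- The non-autonomous system `(X, f_{0,∞})` is chain transitive: for any two points
and any `ε > 0` there is an `ε`-chain from the first to the second. -/
def ChainTransitive {X : Type*} [MetricSpace X] (f : ℕ → X → X) : Prop :=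
  ∀ x y : X, ∀ ε > (0 : ℝ), ∃ m ≥ 1, ∃ c : ℕ → X,
    c 0 = x ∧ c m = y ∧ IsEpsChain f ε c m

theorem exists_selection {X : Type*} [MetricSpace X] (f : ℕ → X → X)
    (F : ℕ → NonemptyCompacts X → NonemptyCompacts X)
    (hF : ∀ k (K : NonemptyCompacts X), (F k K : Set X) = f k '' ↑K)
    (ε : ℝ) (C : ℕ → NonemptyCompacts X) :
    ∃ a : ℕ → X, ∀ k, a k ∈ (C k : Set X) ∧
      (dist (F k (C k)) (C (k + 1)) < ε → dist (f k (a k)) (a (k + 1)) < ε) := by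
  have step : ∀ k, ∀ p : (C k : Set X), ∃ q : (C (k + 1) : Set X),
      dist (F k (C k)) (C (k + 1)) < ε → dist (f k p) q < ε := by
    intro k p
    by_cases hd : dist (F k (C k)) (C (k + 1)) < ε
    · rw [Metric.NonemptyCompacts.dist_eq] at hd
      have hp : f k p ∈ (F k (C k) : Set X) := by
        rw [hF]
        exact ⟨p, p.2, rfl⟩
      obtain ⟨q, hq, hpq⟩ := Metric.exists_dist_lt_of_hausdorffDist_lt hp hd
        (Metric.hausdorffEDist_ne_top_of_nonempty_of_bounded (F k (C k)).nonempty
          (C (k + 1)).nonempty (F k (C k)).isCompact.isBounded (C (k + 1)).isCompact.isBounded)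
      exact ⟨⟨q, hq⟩, fun _ => hpq⟩
    · obtain ⟨q, hq⟩ := (C (k + 1)).nonempty
      exact ⟨⟨q, hq⟩, fun h => absurd h hd⟩
  choose g hg using step
  obtain ⟨a0, ha0⟩ := (C 0).nonempty
  let a : ∀ k, (C k : Set X) := fun k => Nat.rec ⟨a0, ha0⟩ (fun k p => g k p) k
  refine ⟨fun k => (a k).1, fun k => ⟨(a k).2, ?_⟩⟩
  exact hg k (a k)

/-- If the induced hyperspace system `(K(X), \bar f_{0,∞})` is chain weakly mixing of
order `n` (i.e. its `n`-fold product is chain transitive), then so is `(X, f_{0,∞})`.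
Here `F k` is the induced map on the hyperspace `K(X)` of nonempty compact subsets
with the Hausdorff metric, characterized by `F k K = f k '' K`; products carry the
max metric. -/
theorem chainWeaklyMixing_of_hyperspace {X : Type*} [MetricSpace X] [CompactSpace X]
    (f : ℕ → X → X) (hf : ∀ k, Continuous (f k))
    (F : ℕ → NonemptyCompacts X → NonemptyCompacts X)
    (hF : ∀ k (K : NonemptyCompacts X), (F k K : Set X) = f k '' ↑K)
    (n : ℕ) (hn : 1 ≤ n)
    (h : ChainTransitive (fun k (A : Fin n → NonemptyCompacts X) (i : Fin n) => F k (A i))) :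
    ChainTransitive (fun k (x : Fin n → X) (i : Fin n) => f k (x i)) := by
  intro x y ε hε
  obtain ⟨m, hm, c, h0, hcm, hc⟩ := h (fun i => {x i}) (fun i => {y i}) ε hε
  choose a ha using fun i : Fin n => exists_selection f F hF ε (fun k => c k i)
  refine ⟨m, hm, fun k i => a i k, ?_, ?_, ?_⟩
  · funext i
    have := (ha i 0).1
    simpa [h0] using this
  · funext i
    have := (ha i m).1
    simpa [hcm] using this
  · intro k hk
    refine (dist_pi_lt_iff hε).2 fun i => (ha i k).2 ?_
    exact (dist_pi_lt_iff hε).1 (hc k hk) i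
end

section
/- Let (X, f_{0,∞}) be a non-autonomous dynamical system on a compact metric space with f_{0,∞} equi-continuous, and let Λ be a dense subset of X that is invariant under f_{0,∞}. Then (X, f_{0,∞}) is chain transitive if and only if the restricted system (Λ, f_{0,∞}) is chain transitive. -/
open Filter Topology

/-- The restriction of the non-autonomous system `f` to the subset `S` is chain
transitive: for any two points of `S` and any `ε > 0` there is an `ε`-chain
from the first to the second lying entirely in `S`. -/
def ChainTransitiveOn {X : Type*} [MetricSpace X] (f : ℕ → X → X) (S : Set X) : Prop :=
  ∀ x ∈ S, ∀ y ∈ S, ∀ ε > (0 : ℝ), ∃ m ≥ 1, ∃ c : ℕ → X,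
    (∀ i ≤ m, c i ∈ S) ∧ c 0 = x ∧ c m = y ∧ IsEpsChain f ε c m

theorem isEpsChain_perturb {X : Type*} [MetricSpace X] (f : ℕ → X → X) (hef : EquiCont f)
    (ε : ℝ) (hε : 0 < ε) : ∃ r > (0 : ℝ), ∀ (c c' : ℕ → X) (m : ℕ),
      IsEpsChain f (ε / 3) c m → (∀ i, i ≤ m → dist (c' i) (c i) < r) → IsEpsChain f ε c' m := by
  obtain ⟨δ, hδ, h⟩ := hef (ε / 3) (by positivity)
  refine ⟨min δ (ε / 3), lt_min hδ (by positivity), fun c c' m hc hd i hi => ?_⟩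
  have h1 := h _ _ (lt_of_lt_of_le (hd i hi.le) (min_le_left _ _)) i
  have h2 := lt_of_lt_of_le (hd (i + 1) hi) (min_le_right _ _)
  have h3 := hc i hi
  rw [dist_comm] at h2
  have h4 := dist_triangle4 (f i (c' i)) (f i (c i)) (c (i + 1)) (c' (i + 1))
  linarith

/-- Let `Λ` be a dense subset of `X` invariant under the equi-continuous sequence
`f_{0,∞}` of continuous self-maps of the compact metric space `X`. Then `(X, f_{0,∞})`
is chain transitive iff the restricted system `(Λ, f_{0,∞})` is chain transitive. -/
theorem chainTransitive_iff_dense_invariant {X : Type*} [MetricSpace X] [CompactSpace X]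
    (f : ℕ → X → X) (hf : ∀ n, Continuous (f n)) (hef : EquiCont f)
    (Λ : Set X) (hdense : Dense Λ) (hinv : ∀ n, f n '' Λ ⊆ Λ) :
    ChainTransitiveOn f Set.univ ↔ ChainTransitiveOn f Λ := by
  constructor
  · intro H x hx y hy ε hε
    obtain ⟨r, hr, hp⟩ := isEpsChain_perturb f hef ε hε
    obtain ⟨m, hm, c, -, h0, h1, hc⟩ := H x trivial y trivial (ε / 3) (by positivity)
    have key : ∀ z : X, ∃ w ∈ Λ, dist w z < r ∧ (z ∈ Λ → w = z) := by
      intro z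
      by_cases hz : z ∈ Λ
      · exact ⟨z, hz, by simpa using hr, fun _ => rfl⟩
      · obtain ⟨w, hw, hd⟩ := hdense.exists_dist_lt z hr
        exact ⟨w, hw, by rwa [dist_comm], fun h => absurd h hz⟩
    choose g hg hgd hge using key
    refine ⟨m, hm, fun i => g (c i), fun i _ => hg _, ?_, ?_, hp c _ m hc fun i _ => hgd _⟩
    · simp only [h0]
      exact hge x hx
    · simp only [h1]
      exact hge y hy
  · intro H x _ y _ ε hε
    obtain ⟨r, hr, hp⟩ := isEpsChain_perturb f hef ε hε
    obtain ⟨x', hx', hxd⟩ := hdense.exists_dist_lt x hr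
    obtain ⟨y', hy', hyd⟩ := hdense.exists_dist_lt y hr
    obtain ⟨m, hm, c, -, h0, h1, hc⟩ := H x' hx' y' hy' (ε / 3) (by positivity)
    refine ⟨m, hm, fun i => if i = 0 then x else if i = m then y else c i,
      fun i _ => trivial, by simp, ?_, hp c _ m hc fun i _ => ?_⟩
    · have : m ≠ 0 := by omega
      simp [this]
    · show dist (if i = 0 then x else if i = m then y else c i) (c i) < r
      split_ifs with h2 h3
      · rw [h2, h0]; exact hxd
      · rw [h3, h1]; exact hyd
      · simpa using hr
end

section
/- Let (X, f_{0,∞}) be a non-autonomous dynamical system on a compact metric space with f_{0,∞} equi-continuous, and let Λ be a dense subset of X that is invariant under f_{0,∞}. Then (X, f_{0,∞}) is chain mixing if and only if the restricted system (Λ, f_{0,∞}) is chain mixing. -/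
open Filter Topology

/-- The restriction of the non-autonomous system `f` to the subset `S` is chain
mixing: for any two points of `S` and any `ε > 0` there is `N` such that for every
`m ≥ N` there is an `ε`-chain of length `m` between them, lying entirely in `S`. -/
def ChainMixingOn {X : Type*} [MetricSpace X] (f : ℕ → X → X) (S : Set X) : Prop :=
  ∀ x ∈ S, ∀ y ∈ S, ∀ ε > (0 : ℝ), ∃ N ≥ 1, ∀ m ≥ N, ∃ c : ℕ → X,
    (∀ i ≤ m, c i ∈ S) ∧ c 0 = x ∧ c m = y ∧ IsEpsChain f ε c m

/-- Let `Λ` be a dense subset of `X` invariant under the equi-continuous sequence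
`f_{0,∞}` of continuous self-maps of the compact metric space `X`. Then `(X, f_{0,∞})`
is chain mixing iff the restricted system `(Λ, f_{0,∞})` is chain mixing. -/
theorem chainMixing_iff_dense_invariant {X : Type*} [MetricSpace X] [CompactSpace X]
    (f : ℕ → X → X) (hf : ∀ n, Continuous (f n)) (hef : EquiCont f)
    (Λ : Set X) (hdense : Dense Λ) (hinv : ∀ n, f n '' Λ ⊆ Λ) :
    ChainMixingOn f Set.univ ↔ ChainMixingOn f Λ := by
  have key : ∀ ε > (0 : ℝ), ∃ η > (0 : ℝ), ∀ (c c' : ℕ → X) (m : ℕ),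
      (∀ i, dist (c i) (c' i) < η) → IsEpsChain f (ε / 3) c m → IsEpsChain f ε c' m := by
    intro ε hε
    obtain ⟨δ, hδ, h⟩ := hef (ε / 3) (by linarith)
    refine ⟨min δ (ε / 3), lt_min hδ (by linarith), ?_⟩
    intro c c' m hc hch i hi
    have h1 := h (c i) (c' i) (lt_of_lt_of_le (hc i) (min_le_left _ _)) i
    have h2 := lt_of_lt_of_le (hc (i + 1)) (min_le_right _ _)
    have h3 := hch i hi
    have h4 := dist_triangle4 (f i (c' i)) (f i (c i)) (c (i + 1)) (c' (i + 1))
    rw [dist_comm (f i (c' i)) (f i (c i))] at h4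
    linarith
  constructor
  · intro H x hx y hy ε hε
    obtain ⟨η, hη, hk⟩ := key ε hε
    have happ : ∀ p : X, ∃ q ∈ Λ, dist p q < η ∧ (p ∈ Λ → q = p) := by
      intro p
      by_cases hp : p ∈ Λ
      · exact ⟨p, hp, by simpa using hη, fun _ => rfl⟩
      · obtain ⟨q, hq, hpq⟩ := hdense.exists_dist_lt p hη
        exact ⟨q, hq, hpq, fun h => absurd h hp⟩
    choose g hgΛ hgd hge using happ
    obtain ⟨N, hN, hc⟩ := H x trivial y trivial (ε / 3) (by linarith)
    refine ⟨N, hN, fun m hm => ?_⟩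
    obtain ⟨c, -, h0, h1, hch⟩ := hc m hm
    refine ⟨fun i => g (c i), fun i _ => hgΛ _, ?_, ?_, hk c _ m (fun i => hgd _) hch⟩
    · simp only [h0]
      exact hge x hx
    · simp only [h1]
      exact hge y hy
  · intro H x _ y _ ε hε
    obtain ⟨η, hη, hk⟩ := key ε hε
    obtain ⟨x', hx', hxd⟩ := hdense.exists_dist_lt x hη
    obtain ⟨y', hy', hyd⟩ := hdense.exists_dist_lt y hη
    obtain ⟨N, hN, hc⟩ := H x' hx' y' hy' (ε / 3) (by linarith)
    refine ⟨N, hN, fun m hm => ?_⟩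
    obtain ⟨c, -, h0, h1, hch⟩ := hc m hm
    have hm0 : m ≠ 0 := by omega
    refine ⟨fun i => if i = 0 then x else if i = m then y else c i, fun i _ => trivial,
      by simp, by simp [hm0], hk c _ m (fun i => ?_) hch⟩
    by_cases hi : i = 0
    · subst hi
      simpa [h0, dist_comm] using hxd
    · by_cases hi' : i = m
      · subst hi'
        simpa [h1, hi, dist_comm] using hyd
      · simpa [hi, hi'] using hη
end

section
/- Let (X, f_{0,∞}) be a non-autonomous dynamical system on a compact metric space with f_{0,∞} equi-continuous. Then (X, f_{0,∞}) is chain mixing if and only if the induced hyperspace system (K(X), \bar f_{0,∞}) is chain mixing. -/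
open Filter Topology TopologicalSpace

/-- The non-autonomous system `(X, f_{0,∞})` is chain mixing: for any two points and
any `ε > 0` there is `N` such that for every `m ≥ N` there is an `ε`-chain of length
`m` between them. -/
def ChainMixing {X : Type*} [MetricSpace X] (f : ℕ → X → X) : Prop :=
  ∀ x y : X, ∀ ε > (0 : ℝ), ∃ N ≥ 1, ∀ m ≥ N, ∃ c : ℕ → X,
    c 0 = x ∧ c m = y ∧ IsEpsChain f ε c m

/-- On a compact space the length bound in chain mixing can be chosen uniformly. -/
lemma ChainMixing.uniform {X : Type*} [MetricSpace X] [CompactSpace X]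
    (f : ℕ → X → X) (hef : EquiCont f) (h : ChainMixing f) (ε : ℝ) (hε : 0 < ε) :
    ∃ N ≥ 1, ∀ m ≥ N, ∀ x y : X, ∃ c : ℕ → X, c 0 = x ∧ c m = y ∧ IsEpsChain f ε c m := by
  obtain ⟨δ, hδ, hd⟩ := hef (ε / 3) (by positivity)
  set η := min δ (ε / 3) with hη
  have hηpos : 0 < η := lt_min hδ (by positivity)
  obtain ⟨t, -, htf, ht⟩ := Metric.totallyBounded_iff.1
    (isCompact_univ (X := X)).totallyBounded η hηpos |>.imp
      (fun t ht => (⟨trivial, ht.1, ht.2⟩ : True ∧ _ ∧ _))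
  have hnet : ∀ x : X, ∃ a ∈ t, dist x a < η := by
    intro x
    have := ht (Set.mem_univ x)
    simpa using this
  choose N hN1 hN using fun x y : X => h x y (ε / 3) (by positivity)
  refine ⟨1 + ∑ a ∈ htf.toFinset, ∑ b ∈ htf.toFinset, N a b, by omega, ?_⟩
  intro m hm x y
  obtain ⟨a, ha, hxa⟩ := hnet x
  obtain ⟨b, hb, hyb⟩ := hnet y
  have hle : N a b ≤ m := by
    have h1 : N a b ≤ ∑ b ∈ htf.toFinset, N a b :=
      Finset.single_le_sum (f := fun b => N a b) (fun _ _ => Nat.zero_le _) (by simpa using hb)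
    have h2 : ∑ b ∈ htf.toFinset, N a b ≤ ∑ a ∈ htf.toFinset, ∑ b ∈ htf.toFinset, N a b :=
      Finset.single_le_sum (f := fun a => ∑ b ∈ htf.toFinset, N a b)
        (fun _ _ => Nat.zero_le _) (by simpa using ha)
    omega
  have hm1 : 1 ≤ m := by omega
  obtain ⟨c, c0, cm, hc⟩ := hN a b m hle
  refine ⟨fun i => if i = 0 then x else if i = m then y else c i, by simp, ?_, ?_⟩
  · have : m ≠ 0 := by omega
    simp [this]
  · intro i hi
    have hci := hc i hi
    have e1 : dist (f i (if i = 0 then x else if i = m then y else c i)) (f i (c i)) < ε / 3 := by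
      by_cases h0 : i = 0
      · subst h0
        simp only [if_true, c0]
        exact hd _ _ (lt_of_lt_of_le hxa (min_le_left _ _)) 0
      · have : i ≠ m := by omega
        simp only [h0, this, if_false, dist_self]
        positivity
    have e2 : dist (c (i + 1))
        (if i + 1 = 0 then x else if i + 1 = m then y else c (i + 1)) < ε / 3 := by
      by_cases h0 : i + 1 = m
      · have : m ≠ 0 := by omega
        simp only [h0, this, if_true, if_false, cm]
        rw [dist_comm]
        exact lt_of_lt_of_le hyb (min_le_right _ _)
      · simp only [h0, Nat.succ_ne_zero, if_false, dist_self]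
        positivity
    have := dist_triangle4 (f i (if i = 0 then x else if i = m then y else c i)) (f i (c i))
      (c (i + 1)) (if i + 1 = 0 then x else if i + 1 = m then y else c (i + 1))
    show dist (f i (if i = 0 then x else if i = m then y else c i))
      (if i + 1 = 0 then x else if i + 1 = m then y else c (i + 1)) < ε
    linarith

/-- Let `f_{0,∞}` be an equi-continuous sequence of continuous self-maps of a compact
metric space `X`. Then `(X, f_{0,∞})` is chain mixing iff the induced hyperspace system
`(K(X), \bar f_{0,∞})` is chain mixing, where `K(X)` is the space of nonempty compact
subsets of `X` with the Hausdorff metric and `F n` is the induced map, characterized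
by `F n K = f n '' K`. -/
theorem chainMixing_iff_hyperspace {X : Type*} [MetricSpace X] [CompactSpace X]
    (f : ℕ → X → X) (hf : ∀ n, Continuous (f n)) (hef : EquiCont f)
    (F : ℕ → NonemptyCompacts X → NonemptyCompacts X)
    (hF : ∀ n (K : NonemptyCompacts X), (F n K : Set X) = f n '' ↑K) :
    ChainMixing f ↔ ChainMixing F := by
  constructor
  · intro h A B ε hε
    obtain ⟨N, hN1, hN⟩ := ChainMixing.uniform f hef h (ε / 2) (by positivity)
    refine ⟨N, hN1, fun m hm => ?_⟩
    choose c c0 cm hc using hN m hm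
    let S : ℕ → Set X := fun i => {z | ∃ x ∈ A, ∃ y ∈ B, c x y i = z}
    obtain ⟨a, ha⟩ := A.nonempty
    obtain ⟨b, hb⟩ := B.nonempty
    have hS : ∀ i, (S i).Nonempty := fun i => ⟨c a b i, a, ha, b, hb, rfl⟩
    let C : ℕ → NonemptyCompacts X := fun i =>
      ⟨⟨closure (S i), isClosed_closure.isCompact⟩, (hS i).closure⟩
    have hC : ∀ i, (C i : Set X) = closure (S i) := fun i => rfl
    refine ⟨C, ?_, ?_, ?_⟩
    · apply SetLike.coe_injective
      rw [hC]
      have : S 0 = (A : Set X) := by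
        ext z
        constructor
        · rintro ⟨x, hx, y, hy, rfl⟩
          rw [c0]; exact hx
        · intro hz
          exact ⟨z, hz, b, hb, c0 _ _⟩
      rw [this, A.isCompact.isClosed.closure_eq]
    · apply SetLike.coe_injective
      rw [hC]
      have : S m = (B : Set X) := by
        ext z
        constructor
        · rintro ⟨x, hx, y, hy, rfl⟩
          rw [cm]; exact hy
        · intro hz
          exact ⟨a, ha, z, hz, cm _ _⟩
      rw [this, B.isCompact.isClosed.closure_eq]
    · intro i hi
      rw [Metric.NonemptyCompacts.dist_eq, hF, hC, hC, Metric.hausdorffDist_closure₂,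
        ← Metric.hausdorffDist_closure₁, closure_image_closure (hf i),
        Metric.hausdorffDist_closure₁]
      refine lt_of_le_of_lt (Metric.hausdorffDist_le_of_mem_dist (r := ε / 2)
        (by positivity) ?_ ?_) (by linarith)
      · rintro _ ⟨_, ⟨x, hx, y, hy, rfl⟩, rfl⟩
        exact ⟨c x y (i + 1), ⟨x, hx, y, hy, rfl⟩, (hc x y i hi).le⟩
      · rintro _ ⟨x, hx, y, hy, rfl⟩
        refine ⟨f i (c x y i), ⟨_, ⟨x, hx, y, hy, rfl⟩, rfl⟩, ?_⟩
        rw [dist_comm]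
        exact (hc x y i hi).le
  · intro h x y ε hε
    obtain ⟨N, hN1, hN⟩ := h {x} {y} ε hε
    refine ⟨N, hN1, fun m hm => ?_⟩
    obtain ⟨C, C0, Cm, hC⟩ := hN m hm
    have step : ∀ (i : ℕ) (z : X), ∃ w : X, i < m → z ∈ C i →
        w ∈ C (i + 1) ∧ dist (f i z) w < ε := by
      intro i z
      by_cases hi : i < m
      · by_cases hz : z ∈ C i
        · have hd := hC i hi
          rw [Metric.NonemptyCompacts.dist_eq] at hd
          have hmem : f i z ∈ (F i (C i) : Set X) := by
            rw [hF]; exact ⟨z, hz, rfl⟩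
          obtain ⟨w, hw, hzw⟩ := Metric.exists_dist_lt_of_hausdorffDist_lt hmem hd
            (Metric.hausdorffEDist_ne_top_of_nonempty_of_bounded (F i (C i)).nonempty
              (C (i + 1)).nonempty (F i (C i)).isCompact.isBounded
              (C (i + 1)).isCompact.isBounded)
          exact ⟨w, fun _ _ => ⟨hw, hzw⟩⟩
        · exact ⟨z, fun _ h' => absurd h' hz⟩
      · exact ⟨z, fun h' => absurd h' hi⟩
    choose g hg using step
    let c : ℕ → X := fun n => Nat.rec x (fun i z => g i z) n
    have hcm : ∀ i, i ≤ m → c i ∈ C i := by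
      intro i
      induction i with
      | zero =>
        intro _
        rw [C0]
        show x ∈ (({x} : NonemptyCompacts X) : Set X)
        simp
      | succ k ih =>
        intro hk
        exact (hg k (c k) (by omega) (ih (by omega))).1
    refine ⟨c, rfl, ?_, ?_⟩
    · have hmm := hcm m le_rfl
      rw [Cm] at hmm
      have : c m ∈ (({y} : NonemptyCompacts X) : Set X) := hmm
      simpa using this
    · intro i hi
      exact (hg i (c i) hi (hcm i hi.le)).2
end

section
/- Let (X, f_{0,∞}) be a non-autonomous dynamical system on a compact metric space, and let Λ be a dense subset of X that is invariant under f_{0,∞}. If the restricted system (Λ, f_{0,∞}) has finite shadowing, then (X, f_{0,∞}) has finite shadowing. -/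
open Filter Topology

/-- The restriction of the non-autonomous system `f` to the subset `S` has finite
shadowing: for every `ε > 0` there is `δ > 0` such that every finite `δ`-pseudo orbit
`{c 0, …, c m}` in `S` is `ε`-shadowed by some point of `S`. -/
def FiniteShadowingOn {X : Type*} [MetricSpace X] (f : ℕ → X → X) (S : Set X) : Prop :=
  ∀ ε > (0 : ℝ), ∃ δ > (0 : ℝ), ∀ (m : ℕ) (c : ℕ → X),
    (∀ i ≤ m, c i ∈ S) → (∀ i < m, dist (f i (c i)) (c (i + 1)) < δ) →
    ∃ y ∈ S, ∀ k ≤ m, dist (comps f k y) (c k) < ε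

/-- Let `Λ` be a dense subset of the compact metric space `X`, invariant under the
sequence `f_{0,∞}` of continuous self-maps. If the restricted system `(Λ, f_{0,∞})`
has finite shadowing, then `(X, f_{0,∞})` has finite shadowing. -/
theorem finiteShadowing_of_dense_invariant {X : Type*} [MetricSpace X] [CompactSpace X]
    (f : ℕ → X → X) (hf : ∀ n, Continuous (f n))
    (Λ : Set X) (hdense : Dense Λ) (hinv : ∀ n, f n '' Λ ⊆ Λ)
    (h : FiniteShadowingOn f Λ) :
    FiniteShadowingOn f Set.univ := by
  intro ε hε
  obtain ⟨δ, hδ, H⟩ := h (ε / 2) (by linarith)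
  refine ⟨δ / 3, by linarith, fun m c _ hc => ?_⟩
  have key : ∀ i, ∃ z ∈ Λ, dist z (c i) < ε / 2 ∧ dist z (c i) < δ / 3 ∧
      dist (f i z) (f i (c i)) < δ / 3 := by
    intro i
    have h1 : ∀ᶠ z in 𝓝 (c i), dist z (c i) < ε / 2 :=
      Metric.ball_mem_nhds _ (by linarith)
    have h2 : ∀ᶠ z in 𝓝 (c i), dist z (c i) < δ / 3 :=
      Metric.ball_mem_nhds _ (by linarith)
    have h3 : ∀ᶠ z in 𝓝 (c i), dist (f i z) (f i (c i)) < δ / 3 :=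
      (hf i).continuousAt (Metric.ball_mem_nhds (f i (c i)) (by linarith))
    obtain ⟨z, hz, hzΛ⟩ := hdense.inter_nhds_nonempty (h1.and (h2.and h3))
    first
      | exact ⟨z, hzΛ, hz⟩
      | exact ⟨z, hz, hzΛ⟩
  choose b hbΛ hb1 hb2 hb3 using key
  obtain ⟨y, _, hy⟩ := H m b (fun i _ => hbΛ i) (fun i hi => by
    have t1 := dist_triangle4 (f i (b i)) (f i (c i)) (c (i + 1)) (b (i + 1))
    have t2 := hb2 (i + 1)
    rw [dist_comm] at t2
    linarith [hb3 i, hc i hi])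
  refine ⟨y, Set.mem_univ _, fun k hk => ?_⟩
  linarith [dist_triangle (comps f k y) (b k) (c k), hy k hk, hb1 k]
end

section
/- Let (X, f_{0,∞}) be a non-autonomous dynamical system on a compact metric space, and let Λ be a dense subset of X that is invariant under f_{0,∞}. If the restricted system (Λ, f_{0,∞}) has h-shadowing, then (X, f_{0,∞}) has h-shadowing. -/
open Filter Topology

/-- The restriction of the non-autonomous system `f` to the subset `S` has
`h`-shadowing: for every `ε > 0` there is `δ > 0` such that for every finite
`δ`-pseudo orbit `{c 0, …, c m}` in `S` there is `z ∈ S` with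
`dist (f_0^k(z), c k) < ε` for `k < m` and `f_0^m(z) = c m`. -/
def HShadowingOn {X : Type*} [MetricSpace X] (f : ℕ → X → X) (S : Set X) : Prop :=
  ∀ ε > (0 : ℝ), ∃ δ > (0 : ℝ), ∀ (m : ℕ) (c : ℕ → X),
    (∀ i ≤ m, c i ∈ S) → (∀ i < m, dist (f i (c i)) (c (i + 1)) < δ) →
    ∃ z ∈ S, (∀ k < m, dist (comps f k z) (c k) < ε) ∧ comps f m z = c m

theorem continuous_comps {X : Type*} [TopologicalSpace X] (f : ℕ → X → X)
    (hf : ∀ n, Continuous (f n)) (n : ℕ) : Continuous (comps f n) := by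
  induction n with
  | zero => exact continuous_id
  | succ k ih => exact (hf k).comp ih

/-- Let `Λ` be a dense subset of the compact metric space `X`, invariant under the
sequence `f_{0,∞}` of continuous self-maps. If the restricted system `(Λ, f_{0,∞})`
has `h`-shadowing, then `(X, f_{0,∞})` has `h`-shadowing. -/
theorem hShadowing_of_dense_invariant {X : Type*} [MetricSpace X] [CompactSpace X]
    (f : ℕ → X → X) (hf : ∀ n, Continuous (f n))
    (Λ : Set X) (hdense : Dense Λ) (hinv : ∀ n, f n '' Λ ⊆ Λ)
    (h : HShadowingOn f Λ) :
    HShadowingOn f Set.univ := by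
  intro ε hε
  obtain ⟨δ, hδ, H⟩ := h (ε / 2) (half_pos hε)
  refine ⟨δ, hδ, fun m c _ hc => ?_⟩
  have hcomp := continuous_comps f hf
  let K : Set (X × (ℕ → X)) :=
    {p | (∀ k < m, dist (comps f k p.1) (p.2 k) ≤ ε / 2) ∧ comps f m p.1 = p.2 m}
  have hK : IsClosed K := by
    have h1 : IsClosed {p : X × (ℕ → X) | ∀ k < m, dist (comps f k p.1) (p.2 k) ≤ ε / 2} := by
      simp only [Set.setOf_forall]
      refine isClosed_iInter fun k => isClosed_iInter fun _ => ?_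
      exact isClosed_le (((hcomp k).comp continuous_fst).dist
        ((continuous_apply k).comp continuous_snd)) continuous_const
    exact h1.inter (isClosed_eq ((hcomp m).comp continuous_fst)
      ((continuous_apply m).comp continuous_snd))
  have hP : IsClosed (Prod.snd '' K) := isClosedMap_snd_of_compactSpace K hK
  let U : Set (ℕ → X) := {c | ∀ i < m, dist (f i (c i)) (c (i + 1)) < δ}
  have hU : IsOpen U := by
    have : U = ⋂ i ∈ Set.Iio m, {c : ℕ → X | dist (f i (c i)) (c (i + 1)) < δ} := by
      ext c; simp [U]
    rw [this]
    refine (Set.finite_Iio m).isOpen_biInter fun i _ => ?_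
    exact isOpen_lt (((hf i).comp (continuous_apply i)).dist (continuous_apply (i + 1)))
      continuous_const
  have hD : Dense (Set.univ.pi fun _ : ℕ => Λ) := dense_pi _ fun _ _ => hdense
  have hsub : U ∩ (Set.univ.pi fun _ : ℕ => Λ) ⊆ Prod.snd '' K := by
    rintro c' ⟨h1, h2⟩
    obtain ⟨z, _, hz, hzm⟩ := H m c' (fun i _ => h2 i trivial) h1
    exact ⟨(z, c'), ⟨fun k hk => (hz k hk).le, hzm⟩, rfl⟩
  have hcP : c ∈ Prod.snd '' K :=
    closure_minimal hsub hP (hD.open_subset_closure_inter hU hc)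
  obtain ⟨⟨z, c'⟩, ⟨h1, h2⟩, rfl⟩ := hcP
  exact ⟨z, trivial, fun k hk => (h1 k hk).trans_lt (half_lt_self hε), h2⟩
end

section
/- Let (X, f_{0,∞}) be a non-autonomous dynamical system on a compact metric space that has shadowing. If (X, f_{0,∞}) is chain mixing, then (X, f_{0,∞}) is topologically mixing. -/
open Filter Topology

/-- The non-autonomous system `(X, f_{0,∞})` has shadowing. -/
def Shadowing {X : Type*} [MetricSpace X] (f : ℕ → X → X) : Prop :=
  ∀ ε > (0 : ℝ), ∃ δ > (0 : ℝ), ∀ c : ℕ → X,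
    (∀ n : ℕ, dist (f n (c n)) (c (n + 1)) < δ) →
    ∃ y : X, ∀ n : ℕ, dist (comps f n y) (c n) < ε

/-- The non-autonomous system `(X, f_{0,∞})` is topologically mixing. -/
def TopMixing {X : Type*} [MetricSpace X] (f : ℕ → X → X) : Prop :=
  ∀ U V : Set X, IsOpen U → IsOpen V → U.Nonempty → V.Nonempty →
    ∃ N ≥ 1, ∀ n ≥ N, (comps f n '' U ∩ V).Nonempty

/-- If a non-autonomous system on a compact metric space has shadowing and is chain
mixing, then it is topologically mixing. -/
theorem topMixing_of_shadowing_chainMixing {X : Type*} [MetricSpace X] [CompactSpace X]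
    (f : ℕ → X → X) (hf : ∀ n, Continuous (f n))
    (hsh : Shadowing f) (hcm : ChainMixing f) :
    TopMixing f := by
  intro U V hU hV ⟨x, hx⟩ ⟨y, hy⟩
  obtain ⟨a, ha, hUa⟩ := Metric.isOpen_iff.1 hU x hx
  obtain ⟨b, hb, hVb⟩ := Metric.isOpen_iff.1 hV y hy
  obtain ⟨δ, hδ, hs⟩ := hsh (min a b) (lt_min ha hb)
  obtain ⟨N, hN, hc⟩ := hcm x y δ hδ
  refine ⟨N, hN, fun n hn => ?_⟩
  obtain ⟨c, c0, cn, hch⟩ := hc n hn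
  -- extend the chain by the true orbit after time `n`
  let e : ℕ → X := fun k => Nat.rec (c 0) (fun k p => if k + 1 ≤ n then c (k + 1) else f k p) k
  have e_succ : ∀ k, e (k + 1) = if k + 1 ≤ n then c (k + 1) else f k (e k) := fun k => rfl
  have e_le : ∀ k ≤ n, e k = c k := by
    intro k hk
    cases k with
    | zero => rfl
    | succ k => rw [e_succ, if_pos hk]
  obtain ⟨z, hz⟩ := hs e (by
    intro k
    by_cases hk : k + 1 ≤ n
    · rw [e_le k (by omega), e_le (k + 1) hk]
      exact hch k (by omega)
    · rw [e_succ, if_neg hk, dist_self]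
      exact hδ)
  refine ⟨comps f n z, ⟨z, hUa ?_, rfl⟩, hVb ?_⟩
  · have h := hz 0
    rw [e_le 0 (Nat.zero_le n), c0] at h
    exact lt_of_lt_of_le h (min_le_left a b)
  · have h := hz n
    rw [e_le n le_rfl, cn] at h
    exact lt_of_lt_of_le h (min_le_right a b)
end

section
/- Let (X, f_{0,∞}) be a non-autonomous dynamical system on a compact metric space, let F be a Furstenberg family, and let Λ be a dense subset of X that is invariant under f_{0,∞}. If the restricted system (Λ, f_{0,∞}) is multi-F-sensitive, then (X, f_{0,∞}) is multi-F-sensitive. -/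
open Filter Topology

/-- `F` is a (proper) Furstenberg family of subsets of `ℕ`: hereditary upwards,
`∅ ∉ F` and `ℕ ∈ F`. -/
def FurstenbergFamily (F : Set (Set ℕ)) : Prop :=
  (∀ A B : Set ℕ, A ⊆ B → A ∈ F → B ∈ F) ∧ ∅ ∉ F ∧ Set.univ ∈ F

/-- `N_d(x, ε, δ)` for the system restricted to `S`: the set of times `n ≥ 1` for which
some `y ∈ S` with `dist x y < ε` satisfies `dist (f_0^n(x), f_0^n(y)) > δ`. -/
def sensTimes {X : Type*} [MetricSpace X] (f : ℕ → X → X) (S : Set X) (x : X)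
    (ε δ : ℝ) : Set ℕ :=
  {n | 1 ≤ n ∧ ∃ y ∈ S, dist x y < ε ∧ δ < dist (comps f n x) (comps f n y)}

/-- The restriction of the system `f` to `S` is multi-`F`-sensitive: there is a
sensitivity constant `δ > 0` such that `⋂_{i=1}^k N_d(x_i, ε, δ) ∈ F` for all `k ≥ 1`,
all points `x_1, …, x_k ∈ S` and all `ε > 0`. -/
def MultiSensitiveOn {X : Type*} [MetricSpace X] (f : ℕ → X → X) (S : Set X)
    (F : Set (Set ℕ)) : Prop :=
  ∃ δ > (0 : ℝ), ∀ k : ℕ, 1 ≤ k → ∀ x : Fin k → X, (∀ i, x i ∈ S) → ∀ ε > (0 : ℝ),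
    (⋂ i : Fin k, sensTimes f S (x i) ε δ) ∈ F

/-- Let `F` be a Furstenberg family and `Λ` a dense subset of the compact metric space
`X`, invariant under the sequence `f_{0,∞}` of continuous self-maps. If the restricted
system `(Λ, f_{0,∞})` is multi-`F`-sensitive, then `(X, f_{0,∞})` is multi-`F`-sensitive. -/
theorem multiSensitive_of_dense_invariant {X : Type*} [MetricSpace X] [CompactSpace X]
    (f : ℕ → X → X) (hf : ∀ n, Continuous (f n))
    (F : Set (Set ℕ)) (hFam : FurstenbergFamily F)
    (Λ : Set X) (hdense : Dense Λ) (hinv : ∀ n, f n '' Λ ⊆ Λ)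
    (h : MultiSensitiveOn f Λ F) :
    MultiSensitiveOn f Set.univ F := by
  obtain ⟨δ, hδ, H⟩ := h
  refine ⟨δ / 2, by positivity, fun k hk x _ ε hε => ?_⟩
  have hz : ∀ i, ∃ z ∈ Λ, dist (x i) z < ε / 2 := fun i =>
    hdense.exists_dist_lt (x i) (by positivity)
  choose z hzΛ hz using hz
  refine hFam.1 _ _ ?_ (H k hk z hzΛ (ε / 2) (by positivity))
  refine Set.iInter_mono fun i n hn => ?_
  obtain ⟨h1, y, hy, hd, hD⟩ := hn
  refine ⟨h1, ?_⟩
  have hi := hz i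
  by_cases hc : δ / 2 < dist (comps f n (x i)) (comps f n (z i))
  · exact ⟨z i, Set.mem_univ _, by linarith, hc⟩
  · refine ⟨y, Set.mem_univ _, ?_, ?_⟩
    · linarith [dist_triangle (x i) (z i) y]
    · have := dist_triangle_left (comps f n (z i)) (comps f n y) (comps f n (x i))
      linarith
end
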